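/- Let H be the extension of K_4^3 ∪ e, namely the 3-graph obtained from K_4^3 ∪ e by adding, for each of the 12 uncovered pairs {i,j} with i ∈ {1,2,3,4} and j ∈ {5,6,7}, one new vertex v_{ij} (all new vertices distinct) together with the edge {i,j,v_{ij}}. Then the Turán density of H equals √3/3: the sequence ex(n,H)/C(n,3) converges to √3/3 as n → ∞. In particular, there is a single 3-uniform graph whose Turán density is irrational. -/

import Mathlib

open Finset

/-- An `r`-uniform hypergraph (r-graph) with vertices drawn from `ℕ`. -/
structure HyperGraph (r : ℕ) where
  verts : Finset ℕ
  edges : Finset (Finset ℕ)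
  edges_sub : ∀ e ∈ edges, e ⊆ verts
  card_eq : ∀ e ∈ edges, e.card = r

/-- A 3-uniform hypergraph (3-graph). -/
abbrev ThreeGraph := HyperGraph 3

/-- A feasible weight vector on `G`: nonnegative weights on the vertices summing to 1. -/
def HyperGraph.IsFeasible {r : ℕ} (G : HyperGraph r) (w : ℕ → ℝ) : Prop :=
  (∀ v ∈ G.verts, 0 ≤ w v) ∧ ∑ v ∈ G.verts, w v = 1

/-- The Lagrangian function `λ(G, w) = Σ_{e ∈ E(G)} Π_{v ∈ e} w v`. -/
noncomputable def HyperGraph.lagFun {r : ℕ} (G : HyperGraph r) (w : ℕ → ℝ) : ℝ :=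
  ∑ e ∈ G.edges, ∏ v ∈ e, w v

/-- The Lagrangian `λ(G)`: the maximum of `λ(G, w)` over feasible weight vectors. -/
noncomputable def HyperGraph.lag {r : ℕ} (G : HyperGraph r) : ℝ :=
  sSup {x : ℝ | ∃ w, G.IsFeasible w ∧ G.lagFun w = x}

/-- `G` contains a copy of `F`: an injection of the vertices of `F` into those of `G`
mapping every edge of `F` to an edge of `G`. -/
def HyperGraph.ContainsCopy {r : ℕ} (G F : HyperGraph r) : Prop :=
  ∃ f : ℕ → ℕ, Set.InjOn f ↑F.verts ∧ (∀ v ∈ F.verts, f v ∈ G.verts) ∧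
    ∀ e ∈ F.edges, e.image f ∈ G.edges

/-- `G` is `F`-free. -/
def HyperGraph.Free {r : ℕ} (G F : HyperGraph r) : Prop := ¬ G.ContainsCopy F

/-- `H` is a subgraph of `G`. -/
def HyperGraph.IsSubgraph {r : ℕ} (H G : HyperGraph r) : Prop :=
  H.verts ⊆ G.verts ∧ H.edges ⊆ G.edges

/-- `G` is dense: every proper subgraph has strictly smaller Lagrangian. -/
def HyperGraph.LagDense {r : ℕ} (G : HyperGraph r) : Prop :=
  ∀ H : HyperGraph r, H.IsSubgraph G → (H.verts ≠ G.verts ∨ H.edges ≠ G.edges) →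
    H.lag < G.lag

/-- The Lagrangian density `π_λ(F) = sup { r! · λ(G) : G is F-free }`. -/
noncomputable def lagDensity {r : ℕ} (F : HyperGraph r) : ℝ :=
  sSup {x : ℝ | ∃ G : HyperGraph r, G.Free F ∧ x = (Nat.factorial r : ℝ) * G.lag}

/-- An optimum weight vector for `G`. -/
def HyperGraph.IsOptimal {r : ℕ} (G : HyperGraph r) (w : ℕ → ℝ) : Prop :=
  G.IsFeasible w ∧ G.lagFun w = G.lag

/-- `K_4^3 ∪ e`: the disjoint union of the complete 3-graph on `{1,2,3,4}`
and the single edge `{5,6,7}`. -/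
def K43e : ThreeGraph where
  verts := {1, 2, 3, 4, 5, 6, 7}
  edges := {{1, 2, 3}, {1, 2, 4}, {1, 3, 4}, {2, 3, 4}, {5, 6, 7}}
  edges_sub := by decide
  card_eq := by decide

/-- The extension `H` of `K_4^3 ∪ e`: for each uncovered pair `{i, j}` with
`i ∈ {1,2,3,4}`, `j ∈ {5,6,7}`, a new vertex `10 * i + j` is added together with the
edge `{i, j, 10 * i + j}`.  The twelve new vertices are pairwise distinct. -/
def ExtK43e : ThreeGraph where
  verts := {1, 2, 3, 4, 5, 6, 7,
    15, 16, 17, 25, 26, 27, 35, 36, 37, 45, 46, 47}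
  edges := {{1, 2, 3}, {1, 2, 4}, {1, 3, 4}, {2, 3, 4}, {5, 6, 7},
    {1, 5, 15}, {1, 6, 16}, {1, 7, 17},
    {2, 5, 25}, {2, 6, 26}, {2, 7, 27},
    {3, 5, 35}, {3, 6, 36}, {3, 7, 37},
    {4, 5, 45}, {4, 6, 46}, {4, 7, 47}}
  edges_sub := by decide
  card_eq := by decide

/-- The Turán number `ex(n, F)`: the maximum number of edges of an `F`-free
3-graph on the vertex set `{1, …, n}`. -/
noncomputable def turanNumber (F : ThreeGraph) (n : ℕ) : ℕ :=
  sSup {m : ℕ | ∃ G : ThreeGraph, G.verts = Finset.Icc 1 n ∧ G.Free F ∧ G.edges.card = m}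

set_option linter.all false


/-! ### Flag-algebra computation for `K_4^3`-free 3-graphs -/

def bI (b : Bool) : ℤ := if b then 1 else 0

def cC (k : ℤ) : ℤ := if k = 0 then 759 else if k = 1 then 405 else if k = 2 then 72 else -740
def cD (k : ℤ) : ℤ := if k = 0 then 0 else if k = 1 then 684 else if k = 2 then -675 else 559
def cT (k : ℤ) : ℤ := if k = 1 then 556 else if k = 2 then 409 else 0

/-- The five functions whose squares are used. -/
def phi (m : Fin 5) (E e1 e2 e3 : Bool) : ℤ :=
  let k := bI e1 + bI e2 + bI e3
  match m with
  | 0 => if E then 0 else cC k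
  | 1 => if E then 0 else cD k
  | 2 => if E then cT k * (bI e1 - bI e2) else 0
  | 3 => if E then cT k * (bI e2 - bI e3) else 0
  | 4 => if E then cT k * (bI e1 - bI e3) else 0

def GG (E e1 e2 e3 f1 f2 f3 : Bool) : ℤ := ∑ m : Fin 5, phi m E e1 e2 e3 * phi m E f1 f2 f3

/-- The same quantity in a form that is faster to evaluate. -/
def GF (E e1 e2 e3 f1 f2 f3 : Bool) : ℤ :=
  let k := bI e1 + bI e2 + bI e3
  let l := bI f1 + bI f2 + bI f3
  if E then cT k * cT l * ((bI e1 - bI e2) * (bI f1 - bI f2) + (bI e2 - bI e3) * (bI f2 - bI f3)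
    + (bI e1 - bI e3) * (bI f1 - bI f3)) else cC k * cC l + cD k * cD l

theorem GG_eq_GF : ∀ E e1 e2 e3 f1 f2 f3 : Bool,
    GG E e1 e2 e3 f1 f2 f3 = GF E e1 e2 e3 f1 f2 f3 := by
  decide +kernel

theorem flag_check : ∀ b012 b013 b014 b023 b024 b034 b123 b124 b134 b234 : Bool,
    (b012 && b013 && b023 && b123) = false → (b012 && b014 && b024 && b124) = false →
    (b013 && b014 && b034 && b134) = false → (b023 && b024 && b034 && b234) = false →
    (b123 && b124 && b134 && b234) = false →
    1000000 * (bI b012 + bI b013 + bI b014 + bI b023 + bI b024 + bI b034 + bI b123 + bI b124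
      + bI b134 + bI b234)
    + (GF b012 b013 b123 b023 b014 b124 b024
    + GF b013 b012 b123 b023 b014 b134 b034
    + GF b014 b012 b124 b024 b013 b134 b034
    + GF b023 b012 b123 b013 b024 b234 b034
    + GF b024 b012 b124 b014 b023 b234 b034
    + GF b034 b013 b134 b014 b023 b234 b024
    + GF b123 b012 b023 b013 b124 b234 b134
    + GF b124 b012 b024 b014 b123 b234 b134
    + GF b134 b013 b034 b014 b123 b234 b124
    + GF b234 b023 b034 b024 b123 b134 b124) ≤ 5770000 := by
  decide +kernel

section
variable {V : Type*} [Fintype V]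

theorem sum_fin5 (f : (Fin 5 → V) → ℝ) :
    ∑ v, f v = ∑ a, ∑ b, ∑ c, ∑ w, ∑ w', f ![a, b, c, w, w'] := by
  have key : ∀ (n : ℕ) (g : (Fin (n+1) → V) → ℝ), ∑ v, g v = ∑ a, ∑ v, g (Fin.cons a v) := by
    intro n g
    rw [← (Fin.consEquiv (fun _ : Fin (n+1) => V)).sum_comp, Fintype.sum_prod_type]
    rfl
  rw [key]
  refine sum_congr rfl fun a _ => ?_
  rw [key]
  refine sum_congr rfl fun b _ => ?_
  rw [key]
  refine sum_congr rfl fun c _ => ?_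
  rw [key]
  refine sum_congr rfl fun w _ => ?_
  rw [key]
  refine sum_congr rfl fun w' _ => ?_
  rw [Fintype.sum_unique]
  congr 1
  
theorem flag_nonneg (eb : V → V → V → Bool) (x : V → ℝ) (hx : ∀ v, 0 ≤ x v)
    (p : Equiv.Perm (Fin 5)) :
    0 ≤ ∑ v : Fin 5 → V, (∏ i, x (v i)) *
      (GG (eb (v (p 0)) (v (p 1)) (v (p 2)))
        (eb (v (p 0)) (v (p 1)) (v (p 3))) (eb (v (p 1)) (v (p 2)) (v (p 3)))
        (eb (v (p 0)) (v (p 2)) (v (p 3)))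
        (eb (v (p 0)) (v (p 1)) (v (p 4))) (eb (v (p 1)) (v (p 2)) (v (p 4)))
        (eb (v (p 0)) (v (p 2)) (v (p 4))) : ℤ) := by
  have h1 : ∀ v : Fin 5 → V, ∏ i, x (v i) = ∏ i, x (v (p i)) := fun v =>
    (Equiv.prod_comp p (fun i => x (v i))).symm
  have h3 := (Equiv.arrowCongr p.symm (Equiv.refl V)).sum_comp (fun v : Fin 5 → V => (∏ i, x (v i)) *
      ((GG (eb (v 0) (v 1) (v 2)) (eb (v 0) (v 1) (v 3)) (eb (v 1) (v 2) (v 3)) (eb (v 0) (v 2) (v 3))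
       (eb (v 0) (v 1) (v 4)) (eb (v 1) (v 2) (v 4)) (eb (v 0) (v 2) (v 4)) : ℤ) : ℝ))
  refine le_of_le_of_eq ?_ (h3.symm.trans (sum_congr rfl fun v _ => ?_))
  swap
  · rw [h1 v]
    rfl
  rw [sum_fin5]
  refine sum_nonneg fun a _ => sum_nonneg fun b _ => sum_nonneg fun c _ => ?_
  have : ∑ w, ∑ w', (∏ i, x (![a, b, c, w, w'] i)) *
      ((GG (eb a b c) (eb a b w) (eb b c w) (eb a c w) (eb a b w') (eb b c w') (eb a c w') : ℤ) : ℝ)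
      = x a * x b * x c * ∑ m : Fin 5, (∑ w, x w * (phi m (eb a b c) (eb a b w) (eb b c w) (eb a c w) : ℝ)) ^ 2 := by
    have hG : ∀ w w', (∏ i, x (![a, b, c, w, w'] i)) *
      ((GG (eb a b c) (eb a b w) (eb b c w) (eb a c w) (eb a b w') (eb b c w') (eb a c w') : ℤ) : ℝ)
      = ∑ m : Fin 5, (∏ i, x (![a, b, c, w, w'] i)) *
        ((phi m (eb a b c) (eb a b w) (eb b c w) (eb a c w) : ℝ) *
          (phi m (eb a b c) (eb a b w') (eb b c w') (eb a c w') : ℝ)) := by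
      intro w w'
      rw [GG]
      push_cast
      rw [mul_sum]
    simp_rw [hG, sq, sum_mul_sum, mul_sum]
    have hs1 : ∀ g : V → V → Fin 5 → ℝ, ∑ w, ∑ w', ∑ m, g w w' m = ∑ m, ∑ w, ∑ w', g w w' m := by
      intro g
      rw [sum_comm' (t' := univ) (s' := fun _ => univ) (by simp)]
      rw [sum_comm]
      rw [sum_congr rfl fun w _ => sum_comm (f := fun w' m => g w w' m), sum_comm]
    rw [hs1]
    refine sum_congr rfl fun m _ => sum_congr rfl fun w _ => sum_congr rfl fun w' _ => ?_
    simp [Fin.prod_univ_five]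
    ring
  refine le_of_le_of_eq ?_ this.symm
  exact mul_nonneg (mul_nonneg (mul_nonneg (hx _) (hx _)) (hx _)) (sum_nonneg fun m _ => sq_nonneg _)

theorem flag_density (eb : V → V → V → Bool) (x : V → ℝ)
    (hsum : ∑ v, x v = 1) (p : Equiv.Perm (Fin 5)) :
    ∑ v : Fin 5 → V, (∏ i, x (v i)) * ((bI (eb (v (p 0)) (v (p 1)) (v (p 2))) : ℤ) : ℝ)
      = ∑ a, ∑ b, ∑ c, x a * x b * x c * ((bI (eb a b c) : ℤ) : ℝ) := by
  have h1 : ∀ v : Fin 5 → V, ∏ i, x (v i) = ∏ i, x (v (p i)) := fun v =>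
    (Equiv.prod_comp p (fun i => x (v i))).symm
  have h3 := (Equiv.arrowCongr p.symm (Equiv.refl V)).sum_comp (fun v : Fin 5 → V => (∏ i, x (v i)) *
      ((bI (eb (v 0) (v 1) (v 2)) : ℤ) : ℝ))
  refine ((sum_congr rfl fun v _ => ?_).trans h3).trans ?_
  · rw [h1 v]
    rfl
  rw [sum_fin5]
  refine sum_congr rfl fun a _ => sum_congr rfl fun b _ => sum_congr rfl fun c _ => ?_
  have : ∀ w w', (∏ i, x (![a, b, c, w, w'] i)) * ((bI (eb a b c) : ℤ) : ℝ)
      = (x a * x b * x c * ((bI (eb a b c) : ℤ) : ℝ)) * x w * x w' := by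
    intro w w'
    simp [Fin.prod_univ_five]
    ring
  calc _ = ∑ w, ∑ w', (x a * x b * x c * ((bI (eb a b c) : ℤ) : ℝ)) * x w * x w' :=
        sum_congr rfl fun w _ => sum_congr rfl fun w' _ => this w w'
    _ = _ := by
      simp_rw [← mul_sum, hsum, mul_one]
      rw [← mul_sum, hsum, mul_one]

/-- a permutation from an explicit function -/
noncomputable def mkP (f : Fin 5 → Fin 5) (h : Function.Bijective f) : Equiv.Perm (Fin 5) :=
  Equiv.ofBijective f h

theorem flag_main (eb : V → V → V → Bool) (h12 : ∀ a b c, eb a b c = eb b a c)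
    (h23 : ∀ a b c, eb a b c = eb a c b)
    (hK : ∀ a b c d, (eb a b c && eb a b d && eb a c d && eb b c d) = false)
    (x : V → ℝ) (hx : ∀ v, 0 ≤ x v) (hsum : ∑ v, x v = 1) :
    ∑ a, ∑ b, ∑ c, x a * x b * x c * ((bI (eb a b c) : ℤ) : ℝ) ≤ 577 / 1000 := by
  have N := flag_nonneg eb x hx
  have D := flag_density eb x hsum
  set d := ∑ a, ∑ b, ∑ c, x a * x b * x c * ((bI (eb a b c) : ℤ) : ℝ) with hd
  have N1 := N (mkP ![0, 1, 2, 3, 4] (by decide))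
  have N2 := N (mkP ![0, 1, 3, 2, 4] (by decide))
  have N3 := N (mkP ![0, 1, 4, 2, 3] (by decide))
  have N4 := N (mkP ![0, 2, 3, 1, 4] (by decide))
  have N5 := N (mkP ![0, 2, 4, 1, 3] (by decide))
  have N6 := N (mkP ![0, 3, 4, 1, 2] (by decide))
  have N7 := N (mkP ![1, 2, 3, 0, 4] (by decide))
  have N8 := N (mkP ![1, 2, 4, 0, 3] (by decide))
  have N9 := N (mkP ![1, 3, 4, 0, 2] (by decide))
  have N10 := N (mkP ![2, 3, 4, 0, 1] (by decide))
  have D1 := D (mkP ![0, 1, 2, 3, 4] (by decide))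
  have D2 := D (mkP ![0, 1, 3, 2, 4] (by decide))
  have D3 := D (mkP ![0, 1, 4, 2, 3] (by decide))
  have D4 := D (mkP ![0, 2, 3, 1, 4] (by decide))
  have D5 := D (mkP ![0, 2, 4, 1, 3] (by decide))
  have D6 := D (mkP ![0, 3, 4, 1, 2] (by decide))
  have D7 := D (mkP ![1, 2, 3, 0, 4] (by decide))
  have D8 := D (mkP ![1, 2, 4, 0, 3] (by decide))
  have D9 := D (mkP ![1, 3, 4, 0, 2] (by decide))
  have D10 := D (mkP ![2, 3, 4, 0, 1] (by decide))
  simp only [mkP, Equiv.ofBijective_apply, Matrix.cons_val] at N1 N2 N3 N4 N5 N6 N7 N8 N9 N10 D1 D2 D3 D4 D5 D6 D7 D8 D9 D10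
  have one : ∑ v : Fin 5 → V, (∏ i, x (v i)) = 1 := by
    rw [← Fintype.sum_pow, hsum, one_pow]
  have main : 1000000 * ((∑ v : Fin 5 → V, (∏ i, x (v i)) * ((bI (eb (v 0) (v 1) (v 2)) : ℤ) : ℝ))
     + (∑ v : Fin 5 → V, (∏ i, x (v i)) * ((bI (eb (v 0) (v 1) (v 3)) : ℤ) : ℝ))
     + (∑ v : Fin 5 → V, (∏ i, x (v i)) * ((bI (eb (v 0) (v 1) (v 4)) : ℤ) : ℝ))
     + (∑ v : Fin 5 → V, (∏ i, x (v i)) * ((bI (eb (v 0) (v 2) (v 3)) : ℤ) : ℝ))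
     + (∑ v : Fin 5 → V, (∏ i, x (v i)) * ((bI (eb (v 0) (v 2) (v 4)) : ℤ) : ℝ))
     + (∑ v : Fin 5 → V, (∏ i, x (v i)) * ((bI (eb (v 0) (v 3) (v 4)) : ℤ) : ℝ))
     + (∑ v : Fin 5 → V, (∏ i, x (v i)) * ((bI (eb (v 1) (v 2) (v 3)) : ℤ) : ℝ))
     + (∑ v : Fin 5 → V, (∏ i, x (v i)) * ((bI (eb (v 1) (v 2) (v 4)) : ℤ) : ℝ))
     + (∑ v : Fin 5 → V, (∏ i, x (v i)) * ((bI (eb (v 1) (v 3) (v 4)) : ℤ) : ℝ))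
     + (∑ v : Fin 5 → V, (∏ i, x (v i)) * ((bI (eb (v 2) (v 3) (v 4)) : ℤ) : ℝ))) ≤ 5770000 := by
    have S := add_nonneg (add_nonneg (add_nonneg (add_nonneg (add_nonneg (add_nonneg (add_nonneg
      (add_nonneg (add_nonneg N1 N2) N3) N4) N5) N6) N7) N8) N9) N10
    refine le_trans (le_add_of_nonneg_right S) ?_
    rw [← mul_one (5770000 : ℝ), ← one]
    simp only [← sum_add_distrib, mul_sum]
    refine sum_le_sum fun v _ => ?_
    have hX : 0 ≤ ∏ i, x (v i) := prod_nonneg fun i _ => hx _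
    have C := flag_check (eb (v 0) (v 1) (v 2)) (eb (v 0) (v 1) (v 3)) (eb (v 0) (v 1) (v 4))
      (eb (v 0) (v 2) (v 3)) (eb (v 0) (v 2) (v 4)) (eb (v 0) (v 3) (v 4)) (eb (v 1) (v 2) (v 3))
      (eb (v 1) (v 2) (v 4)) (eb (v 1) (v 3) (v 4)) (eb (v 2) (v 3) (v 4))
      (hK _ _ _ _) (hK _ _ _ _) (hK _ _ _ _) (hK _ _ _ _) (hK _ _ _ _)
    have hr1 : ∀ a b c : V, eb b c a = eb a b c := fun a b c => by rw [h23, h12]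
    have hr2 : ∀ a b c : V, eb a c b = eb a b c := fun a b c => (h23 a b c).symm
    simp only [GG_eq_GF, hr1 (v 0) (v 1) (v 2), hr1 (v 0) (v 1) (v 3), hr1 (v 0) (v 1) (v 4),
      hr1 (v 0) (v 2) (v 3), hr1 (v 0) (v 2) (v 4), hr1 (v 0) (v 3) (v 4), hr1 (v 1) (v 2) (v 3),
      hr1 (v 1) (v 2) (v 4), hr1 (v 1) (v 3) (v 4), hr1 (v 2) (v 3) (v 4),
      hr2 (v 0) (v 1) (v 2), hr2 (v 0) (v 1) (v 3), hr2 (v 0) (v 1) (v 4),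
      hr2 (v 0) (v 2) (v 3), hr2 (v 0) (v 2) (v 4), hr2 (v 0) (v 3) (v 4), hr2 (v 1) (v 2) (v 3),
      hr2 (v 1) (v 2) (v 4), hr2 (v 1) (v 3) (v 4), hr2 (v 2) (v 3) (v 4)]
    have C' := mul_le_mul_of_nonneg_left (Int.cast_le (R := ℝ).mpr C) hX
    push_cast at C'
    refine le_trans (le_of_eq ?_) (C'.trans (le_of_eq ?_))
    · ring
    · ring
  rw [D1, D2, D3, D4, D5, D6, D7, D8, D9, D10] at main
  linarith
end


/-! ### Numerical inequalities -/

theorem numR2 (b u v m : ℝ) (hb : 0 ≤ b) (hu : 0 ≤ u) (hv : 0 ≤ v) (hm : 0 ≤ m) :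
    (b+u)*b*m+b*(b+u)^2/2+(2*b+u)*((b+v+m)^2/2-m^2/8)+m^3/16+v*m^2/4+b^2*m/2 ≤ 962/10000*(3*b+u+v+m)^3 := by
  linarith [mul_nonneg (mul_nonneg (hb) hv) hm,
    mul_nonneg (hu) (sq_nonneg ((1)*b + (-1/10)*m)),
    mul_nonneg (hu) (sq_nonneg ((1)*b + (1/20)*u + (1/20)*v + (-2/5)*m)),
    mul_nonneg (hm) (sq_nonneg ((-7/20)*u + (1)*v)),
    mul_nonneg (hb) (sq_nonneg ((1)*b + (-1/5)*v + (-1/2)*m)),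
    mul_nonneg (hm) (sq_nonneg ((-13/20)*u + (1)*v)),
    mul_nonneg (hm) (sq_nonneg ((3/5)*b + (1)*u + (-3/10)*m)),
    mul_nonneg (hm) (sq_nonneg ((-1)*b + (1/5)*u + (-19/20)*v + (1/2)*m)),
    mul_nonneg (hv) (sq_nonneg ((1)*b + (11/20)*u + (-1/2)*v + (-1/10)*m)),
    mul_nonneg (hu) (sq_nonneg ((1)*b + (3/10)*u + (3/5)*v + (-7/20)*m)),
    mul_nonneg (mul_nonneg (hu) hu) hv,
    mul_nonneg (hb) (sq_nonneg ((19/20)*b + (1/20)*u + (1)*v + (-9/20)*m)),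
    mul_nonneg (hm) (sq_nonneg ((1)*b + (1/2)*u + (3/20)*v + (-1/2)*m)),
    mul_nonneg (hv) (sq_nonneg ((1/2)*b + (1)*u + (-1/4)*v + (-3/10)*m)),
    mul_nonneg (mul_nonneg (hb) hu) hu,
    mul_nonneg (hv) (sq_nonneg ((1)*b + (11/20)*u + (-2/5)*v + (-7/20)*m)),
    mul_nonneg (mul_nonneg (hu) hv) hv,
    mul_nonneg (hu) (sq_nonneg ((1)*b + (3/4)*u + (1/20)*v + (-3/10)*m)),
    mul_nonneg (hb) (sq_nonneg ((1)*b + (1/20)*u + (-1/5)*v + (-9/20)*m)),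
    pow_nonneg (show 0 ≤ (3*b+u+v+m) by positivity) 3]

theorem numR1 (r w u m : ℝ) (hr : 0 ≤ r) (hw : 0 ≤ w) (hu : 0 ≤ u) (hm : 0 ≤ m) :
    (r+w+u)*(r+w)*(r+m)-(r+w)*r^2/2+(2*r+2*w+u)*((r+m)^2/2-m^2/8)+m^3/16+r^2*m/2 ≤ 962/10000*(3*r+2*w+u+m)^3 := by
  linarith [mul_nonneg (hr) (sq_nonneg ((1)*r + (-11/20)*u + (-1/2)*m)),
    mul_nonneg (hw) (sq_nonneg ((1)*r + (3/4)*w + (-1/4)*m)),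
    mul_nonneg (mul_nonneg (hu) hu) hm,
    mul_nonneg (mul_nonneg (hu) hu) hu,
    mul_nonneg (hm) (sq_nonneg ((1/5)*r + (-1/2)*w + (1)*u + (-1/10)*m)),
    mul_nonneg (hm) (sq_nonneg ((13/20)*r + (1)*w + (7/20)*u + (-3/10)*m)),
    mul_nonneg (mul_nonneg (hw) hu) hu,
    mul_nonneg (mul_nonneg (hr) hw) hm,
    mul_nonneg (mul_nonneg (hw) hw) hu,
    mul_nonneg (hw) (sq_nonneg ((1/2)*r + (1)*w + (-1/10)*m)),
    mul_nonneg (hr) (sq_nonneg ((1)*r + (7/10)*w + (17/20)*u + (-1/2)*m)),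
    mul_nonneg (hw) (sq_nonneg ((1)*r + (-1/10)*m)),
    mul_nonneg (mul_nonneg (hr) hu) hu,
    mul_nonneg (hr) (sq_nonneg ((1)*r + (9/10)*w + (1/2)*u + (-9/20)*m)),
    mul_nonneg (mul_nonneg (hr) hw) hu,
    mul_nonneg (mul_nonneg (hr) hw) hw,
    mul_nonneg (hw) (sq_nonneg ((4/5)*w + (1)*u + (-2/5)*m)),
    mul_nonneg (hw) (sq_nonneg ((1/10)*r + (1/10)*w + (1)*u + (-1/2)*m)),
    mul_nonneg (mul_nonneg (hr) hu) hm,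
    pow_nonneg (show 0 ≤ (3*r+2*w+u+m) by positivity) 3]


/-- Case 2ii after symmetrisation. -/
theorem num_sym (a b r q y z δ : ℝ) (hb : 0 ≤ b) (hab : b ≤ a) (hr : 0 ≤ r) 
    (hqr : q ≤ r) (hy : 0 ≤ y) (hz : 0 ≤ z) (hs : a + b + r + (y + z) = 1) :
    a * b * (y + z + q) + (a + b) * ((y^2 - δ^2)/4 + z^2/4 + y*z) + (y^2 - δ^2)/4*z + z^2/4*y
      + (a + b)*r*(y+z) + (a+b)*r^2/2 - b*q^2/2 + max (r-b) 0 * (y*z) + min r b * (δ*z) ≤ 962/10000 := by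
  obtain ⟨μ, hμ⟩ : ∃ μ, μ = min r b := ⟨_, rfl⟩
  have hμ0 : 0 ≤ μ := hμ ▸ le_min hr hb
  have hμb : μ ≤ b := hμ ▸ min_le_right _ _
  have hσ : 2 * μ ≤ a + b := by linarith
  -- the δ-inequality
  have key : μ*(δ*z) - (a+b+z)*δ^2/4 - (a+b)*(z-y)^2/8 - (y+z)*(z-y)^2/16 ≤ μ^2*(y+z)/2 := by
    have h1 : μ*(δ*z) - (2*μ+z)*δ^2/4 - (2*μ)*(z-y)^2/8 - (y+z)*(z-y)^2/16 ≤ μ^2*(y+z)/2 := by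
      by_cases h : z ≤ y
      · nlinarith [mul_nonneg hz (sq_nonneg (μ-δ/2)), mul_nonneg hμ0 (sq_nonneg δ),
          mul_nonneg hμ0 (sq_nonneg (z-y)), mul_nonneg (add_nonneg hy hz) (sq_nonneg (z-y)),
          mul_nonneg (sq_nonneg μ) (sub_nonneg.2 h)]
      · obtain ⟨h0, rfl⟩ : ∃ h0, z = y + 2*h0 := ⟨(z-y)/2, by ring⟩
        have hh : 0 ≤ h0 := by linarith
        nlinarith [mul_nonneg hy (sq_nonneg (μ-δ/2)), mul_nonneg hh (sq_nonneg (μ-δ/2)), mul_nonneg hμ0 (sq_nonneg (δ-2*h0)),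
          mul_nonneg hμ0 (sq_nonneg (δ-h0)), mul_nonneg hμ0 (sq_nonneg (δ/2-h0)),
          mul_nonneg hμ0 (sq_nonneg h0), mul_nonneg hy (sq_nonneg h0), mul_nonneg hh (sq_nonneg h0),
          mul_nonneg hh (sq_nonneg δ), mul_nonneg hμ0 (sq_nonneg δ)]
    nlinarith [mul_nonneg (sub_nonneg.2 hσ) (sq_nonneg δ), mul_nonneg (sub_nonneg.2 hσ) (sq_nonneg (z-y))]
  rw [← hμ]
  obtain ⟨m, hm⟩ : ∃ m, m = y + z := ⟨_, rfl⟩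
  have hm0 : 0 ≤ m := by linarith
  have hyz : y * z ≤ m^2/4 := by rw [hm]; nlinarith [sq_nonneg (y-z)]
  have hκ0 : 0 ≤ max (r-b) 0 := le_max_right _ _
  have step : a * b * (y + z + q) + (a + b) * ((y^2 - δ^2)/4 + z^2/4 + y*z) + (y^2 - δ^2)/4*z + z^2/4*y
      + (a + b)*r*(y+z) + (a+b)*r^2/2 - b*q^2/2 + max (r-b) 0 * (y*z) + μ * (δ*z)
      ≤ a*b*(m+q) - b*q^2/2 + (a+b)*((r+m)^2/2-m^2/8)+m^3/16 + max (r-b) 0 * (m^2/4) + μ^2*m/2 := by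
    have := mul_le_mul_of_nonneg_left hyz hκ0
    rw [hm] at *
    linarith
  refine step.trans ?_
  rcases le_total r b with h | h
  · rw [max_eq_right (by linarith), hμ, min_eq_left h]
    have := numR1 r (b-r) (a-b) m hr (by linarith) (by linarith) hm0
    have e1 : 3*r+2*(b-r)+(a-b)+m = 1 := by linarith
    rw [e1] at this
    have hq2 : a*b*q - b*q^2/2 ≤ a*b*r - b*r^2/2 := by
      nlinarith [mul_nonneg hb (mul_nonneg (sub_nonneg.2 hqr) (by linarith : 0 ≤ 2*a - r - q))]
    linarith
  · rw [max_eq_left (by linarith), hμ, min_eq_right h]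
    have := numR2 b (a-b) (r-b) m hb (by linarith) (by linarith) hm0
    have e1 : 3*b+(a-b)+(r-b)+m = 1 := by linarith
    rw [e1] at this
    have hq2 : a*b*q - b*q^2/2 ≤ b*a^2/2 := by
      linarith [mul_nonneg hb (sq_nonneg (a-q))]
    linarith

theorem num_kappa (r b X Y s t : ℝ) (hr : 0 ≤ r) (hb : 0 ≤ b) (hX : 0 ≤ X) (hY : 0 ≤ Y)
    (hs : s = 0 ∨ s = 1) (ht : t = 0 ∨ t = 1) :
    (r*s - b*t)*X + (r*t - b*s)*Y ≤ max (r-b) 0 * (X+Y) + min r b * |X-Y| := by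
  have h0 : 0 ≤ max (r-b) 0 * (X+Y) := mul_nonneg (le_max_right _ _) (by linarith)
  have h1 : 0 ≤ min r b * |X-Y| := mul_nonneg (le_min hr hb) (abs_nonneg _)
  rcases le_total r b with h | h
  · rw [max_eq_right (by linarith), min_eq_left h] at *
    have e1 := mul_le_mul_of_nonneg_left (le_abs_self (X-Y)) hr
    have e2 := mul_le_mul_of_nonneg_left (neg_abs_le (X-Y)) hr
    rcases hs with rfl | rfl <;> rcases ht with rfl | rfl <;>
      nlinarith [mul_nonneg (sub_nonneg.2 h) hX, mul_nonneg (sub_nonneg.2 h) hY]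
  · rw [max_eq_left (by linarith), min_eq_right h] at *
    have e1 := mul_le_mul_of_nonneg_left (le_abs_self (X-Y)) hb
    have e2 := mul_le_mul_of_nonneg_left (neg_abs_le (X-Y)) hb
    rcases hs with rfl | rfl <;> rcases ht with rfl | rfl <;>
      nlinarith [mul_nonneg (sub_nonneg.2 h) hX, mul_nonneg (sub_nonneg.2 h) hY]

/-- Case 2ii, full inequality. -/
theorem num_2ii (a b r q x3 x4 x5 x6 s35 s36 s45 s46 : ℝ) (hb : 0 ≤ b) (hab : b ≤ a) (hr : 0 ≤ r)
    (hq : 0 ≤ q) (hqr : q ≤ r) (h3 : 0 ≤ x3) (h4 : 0 ≤ x4) (h5 : 0 ≤ x5) (h6 : 0 ≤ x6)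
    (hs : a + b + r + (x3 + x4 + x5 + x6) = 1)
    (hs35 : s35 = 0 ∨ s35 = 1) (hs36 : s36 = 0 ∨ s36 = 1) (hs45 : s45 = 0 ∨ s45 = 1)
    (hs46 : s46 = 0 ∨ s46 = 1) :
    a*b*(x3+x4+x5+x6+q) + (a+b)*(x3*x4+x5*x6+(x3+x4)*(x5+x6)) + x3*x4*(x5+x6) + x5*x6*(x3+x4)
      + (a+b)*r*(x3+x4+x5+x6) + (a+b)*r^2/2 - b*q^2/2
      + ((r*s35-b*s46)*(x3*x5) + (r*s46-b*s35)*(x4*x6))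
      + ((r*s36-b*s45)*(x3*x6) + (r*s45-b*s36)*(x4*x5)) ≤ 962/10000 := by
  have k1 := num_kappa r b (x3*x5) (x4*x6) s35 s46 hr hb (by positivity) (by positivity) hs35 hs46
  have k2 := num_kappa r b (x3*x6) (x4*x5) s36 s45 hr hb (by positivity) (by positivity) hs36 hs45
  have hμ : 0 ≤ min r b := le_min hr hb
  have ha : 0 ≤ a := hb.trans hab
  have main : |x3*x5-x4*x6| + |x3*x6-x4*x5| ≤ |x3-x4| * (x5+x6) ∨
      |x3*x5-x4*x6| + |x3*x6-x4*x5| ≤ |x5-x6| * (x3+x4) := by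
    have g : ∀ A B : ℝ, |A| + |B| ≤ |A+B| ∨ |A| + |B| ≤ |A-B| := by
      intro A B
      rcases le_total 0 A with h | h <;> rcases le_total 0 B with h' | h'
      · left; rw [abs_of_nonneg h, abs_of_nonneg h']; exact le_abs_self _
      · right; rw [abs_of_nonneg h, abs_of_nonpos h']; exact le_trans (by linarith) (le_abs_self _)
      · right; rw [abs_of_nonpos h, abs_of_nonneg h']; exact le_trans (by linarith) (neg_le_abs _)
      · left; rw [abs_of_nonpos h, abs_of_nonpos h']; exact le_trans (by linarith) (neg_le_abs _)
    have h34 : 0 ≤ x3 + x4 := by linarith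
    have h56 : 0 ≤ x5 + x6 := by linarith
    rcases g (x3*x5-x4*x6) (x3*x6-x4*x5) with h | h
    · left
      rwa [show x3*x5-x4*x6+(x3*x6-x4*x5) = (x3-x4)*(x5+x6) by ring, abs_mul, abs_of_nonneg h56] at h
    · right
      rwa [show x3*x5-x4*x6-(x3*x6-x4*x5) = (x5-x6)*(x3+x4) by ring, abs_mul, abs_of_nonneg h34] at h
  rcases main with h | h
  · have A := num_sym a b r q (x3+x4) (x5+x6) |x3-x4| hb hab hr hqr (by linarith) (by linarith)
      (by linarith)
    have hh := mul_le_mul_of_nonneg_left h hμ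
    rw [sq_abs] at A
    linarith [mul_nonneg h3 (sq_nonneg (x5-x6)), mul_nonneg h4 (sq_nonneg (x5-x6)),
      mul_nonneg ha (sq_nonneg (x5-x6)), mul_nonneg hb (sq_nonneg (x5-x6))]
  · have A := num_sym a b r q (x5+x6) (x3+x4) |x5-x6| hb hab hr hqr (by linarith) (by linarith)
      (by linarith)
    have hh := mul_le_mul_of_nonneg_left h hμ
    rw [sq_abs] at A
    linarith [mul_nonneg h5 (sq_nonneg (x3-x4)), mul_nonneg h6 (sq_nonneg (x3-x4)),
      mul_nonneg ha (sq_nonneg (x3-x4)), mul_nonneg hb (sq_nonneg (x3-x4))]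


theorem num_e2 (x1 x2 x3 x4 : ℝ) :
    x1*x2+x1*x3+x1*x4+x2*x3+x2*x4+x3*x4 ≤ 3/8*(x1+x2+x3+x4)^2 := by
  linarith [sq_nonneg (x1-x2), sq_nonneg (x1-x3), sq_nonneg (x1-x4), sq_nonneg (x2-x3),
    sq_nonneg (x2-x4), sq_nonneg (x3-x4)]

theorem num_e3 (x1 x2 x3 x4 : ℝ) (h1 : 0 ≤ x1) (h2 : 0 ≤ x2) (h3 : 0 ≤ x3) (h4 : 0 ≤ x4) :
    x1*x2*x3+x1*x2*x4+x1*x3*x4+x2*x3*x4 ≤ (x1+x2+x3+x4)^3/16 := by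
  have A : x1*x2*x3+x1*x2*x4+x1*x3*x4+x2*x3*x4 ≤ (x1+x2)^2/4*(x3+x4)+(x3+x4)^2/4*(x1+x2) := by
    linarith [mul_nonneg (add_nonneg h3 h4) (sq_nonneg (x1-x2)), mul_nonneg (add_nonneg h1 h2) (sq_nonneg (x3-x4))]
  linarith [mul_nonneg (add_nonneg (add_nonneg h1 h2) (add_nonneg h3 h4)) (sq_nonneg (x1+x2-x3-x4))]

theorem num_1a (s : ℝ) (h0 : 0 ≤ s) (h1 : s ≤ 1/2) :
    3/8*s^3+9/8*(1-s)*s^2+3*(1-s)^2*s ≤ 5772/10000 := by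
  nlinarith [mul_nonneg h0 (sq_nonneg (s-0.38)), sq_nonneg (s-0.38), sq_nonneg (s-0.4), mul_nonneg h0 (sub_nonneg.2 h1), mul_nonneg (mul_nonneg h0 (sub_nonneg.2 h1)) h0,
   mul_nonneg (sub_nonneg.2 h1) (sq_nonneg (s-0.38)), mul_nonneg (sub_nonneg.2 h1) (sq_nonneg (s-0.4))]

theorem num_1b (s : ℝ) (h0 : 1/2 ≤ s) (h1 : s ≤ 1) :
    3/8*s^3+9/8*(1-s)*s^2+3/2*(1-s)^3+3/2*(1-s)*s^2 ≤ 5772/10000 := by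
  nlinarith [mul_nonneg (sub_nonneg.2 h0) (sub_nonneg.2 h1), mul_nonneg (sub_nonneg.2 h0) (sq_nonneg (s-0.7)), mul_nonneg (sub_nonneg.2 h1) (sq_nonneg (s-0.7)), mul_nonneg (mul_nonneg (sub_nonneg.2 h0) (sub_nonneg.2 h1)) (sub_nonneg.2 h0), mul_nonneg (mul_nonneg (sub_nonneg.2 h0) (sub_nonneg.2 h1)) (sub_nonneg.2 h1)]

theorem num_pa (r x1 x2 x3 x4 l1 l2 l3 l4 : ℝ) (h1 : 0 ≤ x1) (h2 : 0 ≤ x2) (h3 : 0 ≤ x3)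
    (h4 : 0 ≤ x4) (hr : x1+x2+x3+x4 ≤ r) (hl1 : l1 = 0 ∨ l1 = 1) (hl2 : l2 = 0 ∨ l2 = 1)
    (hl3 : l3 = 0 ∨ l3 = 1) (hl4 : l4 = 0 ∨ l4 = 1) :
    r*(x1*l1+x2*l2+x3*l3+x4*l4) - (x1*x2*(l1*l2)+x1*x3*(l1*l3)+x1*x4*(l1*l4)+x2*x3*(l2*l3)
      +x2*x4*(l2*l4)+x3*x4*(l3*l4)) ≤ r*(x1+x2+x3+x4) - (x1*x2+x1*x3+x1*x4+x2*x3+x2*x4+x3*x4) := by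
  have a1 := mul_nonneg h1 (sub_nonneg.2 hr)
  have a2 := mul_nonneg h2 (sub_nonneg.2 hr)
  have a3 := mul_nonneg h3 (sub_nonneg.2 hr)
  have a4 := mul_nonneg h4 (sub_nonneg.2 hr)
  have := mul_nonneg h1 h2
  have := mul_nonneg h1 h3
  have := mul_nonneg h1 h4
  have := mul_nonneg h2 h3
  have := mul_nonneg h2 h4
  have := mul_nonneg h3 h4
  have := mul_nonneg h1 h1
  have := mul_nonneg h2 h2
  have := mul_nonneg h3 h3
  have := mul_nonneg h4 h4
  rcases hl1 with rfl | rfl <;> rcases hl2 with rfl | rfl <;> rcases hl3 with rfl | rfl <;>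
    rcases hl4 with rfl | rfl <;> linarith

theorem num_pb (r x1 x2 x3 x4 l1 l2 l3 l4 : ℝ) 
    (hl1 : l1 = 0 ∨ l1 = 1) (hl2 : l2 = 0 ∨ l2 = 1)
    (hl3 : l3 = 0 ∨ l3 = 1) (hl4 : l4 = 0 ∨ l4 = 1) :
    r*(x1*l1+x2*l2+x3*l3+x4*l4) - (x1*x2*(l1*l2)+x1*x3*(l1*l3)+x1*x4*(l1*l4)+x2*x3*(l2*l3)
      +x2*x4*(l2*l4)+x3*x4*(l3*l4)) ≤ r^2/2+(x1+x2+x3+x4)^2/2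
        - (x1*x2+x1*x3+x1*x4+x2*x3+x2*x4+x3*x4) := by
  have q : ∀ x l : ℝ, l = 0 ∨ l = 1 → (x*l)^2 ≤ x^2 := by
    rintro x l (rfl | rfl)
    · simpa using sq_nonneg x
    · simp
  linarith [sq_nonneg (r - (x1*l1+x2*l2+x3*l3+x4*l4)), q x1 l1 hl1, q x2 l2 hl2, q x3 l3 hl3, q x4 l4 hl4]

theorem num_2i (a b A B C : ℝ) (ha : 0 ≤ a) (hb : 0 ≤ b) (hA : 0 ≤ A) (hB : 0 ≤ B) (hC : 0 ≤ C)
    (hs : A + B + C ≤ 1 - a - b) :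
    6*a*b*(1-a-b) + 3*(a+b)*((1-a-b)^2 - (A^2+B^2+C^2)/2) + 6*A*B*C ≤ √3/3 := by
  obtain ⟨σ, hσ⟩ : ∃ σ, σ = a + b := ⟨_, rfl⟩
  obtain ⟨Q, hQ⟩ : ∃ Q, Q = A^2+B^2+C^2 := ⟨_, rfl⟩
  obtain ⟨Y, hY⟩ : ∃ Y, Y = A + B + C := ⟨_, rfl⟩
  have hσ0 : 0 ≤ σ := by linarith
  have hY0 : 0 ≤ Y := by linarith
  have hQ0 : 0 ≤ Q := by rw [hQ]; positivity
  have hQY : Y^2 ≤ 3*Q := by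
    rw [hQ, hY]; linarith [sq_nonneg (A-B), sq_nonneg (A-C), sq_nonneg (B-C)]
  have hc : Y ≤ 1 - σ := by linarith
  have hc0 : 0 ≤ 1 - σ := by linarith
  have h1 : 6*a*b*(1-a-b) ≤ 3/2*σ^2*(1-σ) := by
    rw [hσ]; linarith [mul_nonneg (by linarith : 0 ≤ 1-a-b) (sq_nonneg (a-b))]
  have h2 : 6*A*B*C ≤ 2/3*(Y*Q) := by
    rw [hQ, hY]
    nlinarith [mul_nonneg hA (sq_nonneg (B-C)), mul_nonneg hB (sq_nonneg (A-C)), mul_nonneg hC (sq_nonneg (A-B)),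
      mul_nonneg hA (sq_nonneg (A-C)), mul_nonneg hB (sq_nonneg (B-C)), mul_nonneg hA (sq_nonneg (A-B)),
      mul_nonneg hB (sq_nonneg (A-B)), mul_nonneg hC (sq_nonneg (A-C)), mul_nonneg hC (sq_nonneg (B-C))]
  have h3 : 6*A*B*C ≤ 2/9*Y^3 := by
    rw [hY]
    nlinarith [mul_nonneg hA (sq_nonneg (B-C)), mul_nonneg hB (sq_nonneg (A-C)), mul_nonneg hC (sq_nonneg (A-B)),
      mul_nonneg hA (sq_nonneg (A-C)), mul_nonneg hB (sq_nonneg (B-C)), mul_nonneg hA (sq_nonneg (A-B)),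
      mul_nonneg hB (sq_nonneg (A-B)), mul_nonneg hC (sq_nonneg (A-C)), mul_nonneg hC (sq_nonneg (B-C))]
  have e1 : 1 - a - b = 1 - σ := by linarith
  rw [← hQ]
  rw [e1] at h1 ⊢
  rw [← hσ]
  rcases le_total (4/13) σ with h | h
  · have B1 : 3/2*σ^2*(1-σ) + 3*σ*(1-σ)^2 ≤ √3/3 := by
      have hk : √3 ^ 2 = 3 := Real.sq_sqrt (by norm_num)
      have hk0 : 0 ≤ √3 := Real.sqrt_nonneg 3
      have hk3 : √3 ^ 3 = 3 * √3 := by rw [pow_succ, hk]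
      have := mul_nonneg (by linarith : 0 ≤ (1-σ) + 2*(√3/3)) (sq_nonneg ((1-σ) - √3/3))
      have e : ((1-σ) + 2*(√3/3)) * ((1-σ) - √3/3)^2 = (1-σ)^3 - 3*(√3^2/9)*(1-σ) + 2*(√3^3/27) := by ring
      rw [e, hk, hk3] at this
      linarith
    have B2 : 2/3*(Y*Q) ≤ 3/2*(σ*Q) := by
      nlinarith [mul_nonneg hQ0 (by linarith : 0 ≤ 9/4*σ - Y)]
    linarith
  · have s3 : (1.7320 : ℝ) ≤ √3 := Real.le_sqrt_of_sq_le (by norm_num)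
    have B1 : 2/9*Y^3 - σ/2*Y^2 ≤ 2/9*(1-σ)^3 - σ/2*(1-σ)^2 := by
      rcases le_total (2/9*Y) (σ/2) with g | g
      · have := mul_nonneg (sq_nonneg Y) (sub_nonneg.2 g)
        have := mul_nonneg (sq_nonneg (1-σ)) (by linarith : 0 ≤ 2/9*(1-σ) - σ/2)
        linarith
      · have g1 : Y^2 ≤ (1-σ)^2 := by nlinarith
        have := mul_le_mul g1 (by linarith : 2/9*Y-σ/2 ≤ 2/9*(1-σ)-σ/2) (by linarith) (sq_nonneg _)
        linarith
    have B2 : 3/2*σ^2*(1-σ) + 3*σ*(1-σ)^2 + 2/9*(1-σ)^3 - σ/2*(1-σ)^2 ≤ 57/100 := by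
      nlinarith [mul_nonneg hσ0 (sub_nonneg.2 h), mul_nonneg (mul_nonneg hσ0 (sub_nonneg.2 h)) hσ0]
    have B3 := mul_le_mul_of_nonneg_left hQY hσ0
    linarith




section
variable {V : Type*} [Fintype V] [DecidableEq V]

/-- symmetric irreflexive ternary relation -/
structure Sym3 (eb : V → V → V → Bool) : Prop where
  h12 : ∀ a b c, eb a b c = eb b a c
  h23 : ∀ a b c, eb a b c = eb a c b
  irr : ∀ a c, eb a a c = false

noncomputable def ev (eb : V → V → V → Bool) (a b c : V) : ℝ := ((bI (eb a b c) : ℤ) : ℝ)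
noncomputable def lF (eb : V → V → V → Bool) (x : V → ℝ) (a b : V) : ℝ := ∑ w, x w * ev eb a b w
noncomputable def qF (eb : V → V → V → Bool) (x : V → ℝ) (a : V) : ℝ := ∑ u, x u * lF eb x a u
noncomputable def dF (eb : V → V → V → Bool) (x : V → ℝ) : ℝ := ∑ c, x c * qF eb x c

def isK4 (eb : V → V → V → Bool) (a b c d : V) : Prop :=
  eb a b c = true ∧ eb a b d = true ∧ eb a c d = true ∧ eb b c d = true

def MeetK4 (eb : V → V → V → Bool) : Prop := ∀ a b c d, isK4 eb a b c d → ∀ u v w, eb u v w = true →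
  u ∈ ({a, b, c, d} : Finset V) ∨ v ∈ ({a, b, c, d} : Finset V) ∨ w ∈ ({a, b, c, d} : Finset V)

variable {eb : V → V → V → Bool}

theorem ev_zero {a b c : V} (h : eb a b c = false) : ev eb a b c = 0 := by simp [ev, bI, h]
theorem ev_one {a b c : V} (h : eb a b c = true) : ev eb a b c = 1 := by simp [ev, bI, h]
theorem ev_cases (eb : V → V → V → Bool) (a b c : V) : ev eb a b c = 0 ∨ ev eb a b c = 1 := by
  cases h : eb a b c
  · exact Or.inl (ev_zero h)
  · exact Or.inr (ev_one h)
theorem ev_nonneg (a b c : V) : 0 ≤ ev eb a b c := by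
  rcases ev_cases eb a b c with h | h <;> rw [h] <;> norm_num
theorem ev_le_one (a b c : V) : ev eb a b c ≤ 1 := by
  rcases ev_cases eb a b c with h | h <;> rw [h]; norm_num

theorem Sym3.ev12 (hs : Sym3 eb) (a b c : V) : ev eb a b c = ev eb b a c := by rw [ev, hs.h12, ev]
theorem Sym3.ev23 (hs : Sym3 eb) (a b c : V) : ev eb a b c = ev eb a c b := by rw [ev, hs.h23, ev]
theorem Sym3.irr23 (hs : Sym3 eb) (a c : V) : eb a c c = false := by
  rw [hs.h12, hs.h23, hs.irr]
theorem Sym3.irr13 (hs : Sym3 eb) (a c : V) : eb a c a = false := by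
  rw [hs.h23, hs.irr]
theorem Sym3.ne (hs : Sym3 eb) {a b c : V} (h : eb a b c = true) : a ≠ b ∧ a ≠ c ∧ b ≠ c := by
  refine ⟨?_, ?_, ?_⟩ <;> rintro rfl
  · simp [hs.irr] at h
  · simp [hs.irr13] at h
  · simp [hs.irr23] at h
theorem Sym3.l12 (hs : Sym3 eb) (x : V → ℝ) (a b : V) : lF eb x a b = lF eb x b a :=
  sum_congr rfl fun w _ => by rw [hs.ev12]

theorem sum_peel (x g : V → ℝ) (a : V) :
    ∑ w, x w * g w = ∑ w, Function.update x a 0 w * g w + x a * g a := by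
  have : ∀ w, x w * g w = Function.update x a 0 w * g w + if w = a then x a * g a else 0 := by
    intro w
    by_cases h : w = a
    · subst h; simp
    · simp [h]
  rw [sum_congr rfl fun w _ => this w, sum_add_distrib]
  simp

theorem l_peel (x : V → ℝ) (a b c : V) :
    lF eb x b c = lF eb (Function.update x a 0) b c + x a * ev eb b c a := sum_peel _ _ _

theorem q_peel (hs : Sym3 eb) (x : V → ℝ) (a b : V) :
    qF eb x b = qF eb (Function.update x a 0) b + 2 * x a * lF eb (Function.update x a 0) b a := by
  have h1 : qF eb x b = _ := sum_peel x (lF eb x b) a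
  rw [h1, l_peel x a b a, ev_zero (hs.irr23 b a)]
  have h2 : ∑ w, Function.update x a 0 w * lF eb x b w = qF eb (Function.update x a 0) b
      + x a * lF eb (Function.update x a 0) b a := by
    rw [qF, lF, mul_sum, ← sum_add_distrib]
    refine sum_congr rfl fun w _ => ?_
    rw [l_peel x a b w, hs.ev23 b w a]
    ring
  rw [h2]; ring

theorem d_peel (hs : Sym3 eb) (x : V → ℝ) (a : V) :
    dF eb x = dF eb (Function.update x a 0) + 3 * x a * qF eb (Function.update x a 0) a := by
  have h1 : dF eb x = _ := sum_peel x (qF eb x) a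
  have h0 : lF eb (Function.update x a 0) a a = 0 :=
    sum_eq_zero fun w _ => by rw [ev_zero (hs.irr a w), mul_zero]
  rw [h1, q_peel hs x a a, h0]
  have h2 : ∑ w, Function.update x a 0 w * qF eb x w = dF eb (Function.update x a 0)
      + 2 * x a * qF eb (Function.update x a 0) a := by
    rw [dF, qF, mul_sum, ← sum_add_distrib]
    refine sum_congr rfl fun w _ => ?_
    rw [q_peel hs x a w, hs.l12 _ a w]
    ring
  rw [h2]; ring

theorem sum_peel1 (x : V → ℝ) (a : V) : ∑ w, x w = ∑ w, Function.update x a 0 w + x a := by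
  simpa using sum_peel x (fun _ => 1) a

theorem l_le (y : V → ℝ) (hy : ∀ v, 0 ≤ y v) (a b : V) : lF eb y a b ≤ ∑ w, y w :=
  sum_le_sum fun w _ => mul_le_of_le_one_right (hy w) (ev_le_one _ _ _)
theorem l_nonneg (y : V → ℝ) (hy : ∀ v, 0 ≤ y v) (a b : V) : 0 ≤ lF eb y a b :=
  sum_nonneg fun w _ => mul_nonneg (hy w) (ev_nonneg _ _ _)

theorem q_eq (y : V → ℝ) (a : V) : qF eb y a = ∑ u, ∑ v, y u * y v * ev eb a u v := by
  rw [qF]; simp_rw [lF, mul_sum, mul_assoc]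
theorem d_eq (y : V → ℝ) : dF eb y = ∑ c, ∑ u, ∑ v, y c * y u * y v * ev eb c u v := by
  rw [dF]; simp_rw [q_eq, mul_sum, mul_assoc]

theorem sum_mul_two (y : V → ℝ) : ∑ u, ∑ v, y u * y v = (∑ u, y u)^2 := by
  rw [sq, sum_mul_sum]

/-- `y` vanishes at every vertex of `S`; an edge-value is zero off `S` then the sum vanishes. -/
theorem l_zero (y : V → ℝ) (a b : V) (h : ∀ w, y w ≠ 0 → eb a b w = false) : lF eb y a b = 0 :=
  sum_eq_zero fun w _ => by
    by_cases hw : y w = 0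
    · rw [hw, zero_mul]
    · rw [ev_zero (h w hw), mul_zero]
theorem q_zero (y : V → ℝ) (a : V) (h : ∀ u w, y u ≠ 0 → y w ≠ 0 → eb a u w = false) :
    qF eb y a = 0 :=
  sum_eq_zero fun u _ => by
    by_cases hw : y u = 0
    · rw [hw, zero_mul]
    · rw [l_zero y a u (fun w => h u w hw), mul_zero]
theorem d_zero (y : V → ℝ)
    (h : ∀ c u w, y c ≠ 0 → y u ≠ 0 → y w ≠ 0 → eb c u w = false) : dF eb y = 0 :=
  sum_eq_zero fun u _ => by
    by_cases hw : y u = 0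
    · rw [hw, zero_mul]
    · rw [q_zero y u (fun v w => h u v w hw), mul_zero]

theorem upd_nonneg {x : V → ℝ} (hx : ∀ v, 0 ≤ x v) (a : V) : ∀ v, 0 ≤ Function.update x a 0 v := by
  intro v
  by_cases h : v = a
  · subst h; simp
  · simp [h, hx v]
theorem upd_ne {x : V → ℝ} {a v : V} (h : Function.update x a 0 v ≠ 0) : v ≠ a ∧ x v ≠ 0 := by
  by_cases h' : v = a
  · subst h'; simp at h
  · exact ⟨h', by simpa [h'] using h⟩
end


section
variable {V : Type*} [Fintype V] [DecidableEq V] {eb : V → V → V → Bool}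

theorem peel (hs : Sym3 eb) (x : V → ℝ) (hx : ∀ v, 0 ≤ x v) (a : V) :
    ∃ y : V → ℝ, (∀ v, 0 ≤ y v) ∧ (∀ v, y v ≠ 0 → v ≠ a ∧ x v ≠ 0) ∧ (∀ v, v ≠ a → y v = x v) ∧
      ∑ v, y v = ∑ v, x v - x a ∧ dF eb x = dF eb y + 3 * x a * qF eb y a ∧
      (∀ b, qF eb x b = qF eb y b + 2 * x a * lF eb y b a) ∧
      (∀ b c, lF eb x b c = lF eb y b c + x a * ev eb b c a) := by
  refine ⟨Function.update x a 0, upd_nonneg hx a, fun v => upd_ne, fun v hv => by simp [hv], ?_,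
    d_peel hs x a, q_peel hs x a, fun b c => l_peel x a b c⟩
  rw [sum_peel1 x a]; ring

theorem peel2 (hs : Sym3 eb) (x : V → ℝ) (hx : ∀ v, 0 ≤ x v) (v1 v2 : V)
    (hnd : [v1, v2].Nodup) :
    ∃ y : V → ℝ, (∀ v, 0 ≤ y v) ∧ (∀ v, y v ≠ 0 → v ≠ v1 ∧ v ≠ v2) ∧
      (∀ v, v ≠ v1 → v ≠ v2 → y v = x v) ∧
      ∑ v, y v = ∑ v, x v - x v1 - x v2 ∧
      dF eb x = dF eb y + 3 * (x v1 * qF eb y v1 + x v2 * qF eb y v2)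
        + 6 * (x v1 * x v2 * lF eb y v1 v2) := by
  simp only [List.nodup_cons, List.mem_cons, List.not_mem_nil, not_or, or_false] at hnd
  obtain ⟨x1, p1, n1, e1, s1, d1, q1, l1⟩ := peel hs x hx v1
  obtain ⟨x2, p2, n2, e2, s2, d2, q2, l2⟩ := peel hs x1 p1 v2
  have t2 : x1 v2 = x v2 := e1 _ (by tauto)
  refine ⟨x2, p2, fun v hv => ?_, fun v a1 a2 => ?_, ?_, ?_⟩
  · have b2 := n2 v hv
    have b1 := n1 v b2.2
    exact ⟨b1.1, b2.1⟩
  · rw [e2 v a2, e1 v a1]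
  · rw [s2, s1, t2]
  · rw [d1, d2]
    simp only [q2, t2]
    ring

theorem peel4 (hs : Sym3 eb) (x : V → ℝ) (hx : ∀ v, 0 ≤ x v) (v1 v2 v3 v4 : V)
    (hnd : [v1, v2, v3, v4].Nodup) :
    ∃ y : V → ℝ, (∀ v, 0 ≤ y v) ∧ (∀ v, y v ≠ 0 → v ≠ v1 ∧ v ≠ v2 ∧ v ≠ v3 ∧ v ≠ v4) ∧
      ∑ v, y v = ∑ v, x v - x v1 - x v2 - x v3 - x v4 ∧
      dF eb x = dF eb y + 3 * (x v1 * qF eb y v1 + x v2 * qF eb y v2 + x v3 * qF eb y v3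
          + x v4 * qF eb y v4)
        + 6 * (x v1 * x v2 * lF eb y v1 v2 + x v1 * x v3 * lF eb y v1 v3
          + x v1 * x v4 * lF eb y v1 v4 + x v2 * x v3 * lF eb y v2 v3
          + x v2 * x v4 * lF eb y v2 v4 + x v3 * x v4 * lF eb y v3 v4)
        + 6 * (x v1 * x v2 * x v3 * ev eb v1 v2 v3 + x v1 * x v2 * x v4 * ev eb v1 v2 v4
          + x v1 * x v3 * x v4 * ev eb v1 v3 v4 + x v2 * x v3 * x v4 * ev eb v2 v3 v4) := by
  simp only [List.nodup_cons, List.mem_cons, List.not_mem_nil, not_or, or_false] at hnd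
  obtain ⟨x1, p1, n1, e1, s1, d1, q1, l1⟩ := peel hs x hx v1
  obtain ⟨x2, p2, n2, e2, s2, d2, q2, l2⟩ := peel hs x1 p1 v2
  obtain ⟨x3, p3, n3, e3, s3, d3, q3, l3⟩ := peel hs x2 p2 v3
  obtain ⟨x4, p4, n4, e4, s4, d4, q4, l4⟩ := peel hs x3 p3 v4
  have t2 : x1 v2 = x v2 := e1 _ (by tauto)
  have t3 : x2 v3 = x v3 := by rw [e2 _ (by tauto), e1 _ (by tauto)]
  have t4 : x3 v4 = x v4 := by rw [e3 _ (by tauto), e2 _ (by tauto), e1 _ (by tauto)]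
  refine ⟨x4, p4, fun v hv => ?_, ?_, ?_⟩
  · have b4 := n4 v hv
    have b3 := n3 v b4.2
    have b2 := n2 v b3.2
    have b1 := n1 v b2.2
    exact ⟨b1.1, b2.1, b3.1, b4.1⟩
  · rw [s4, s3, s2, s1, t2, t3, t4]
  · rw [d1, d2, d3, d4]
    simp only [q2, q3, q4, l3, l4, t2, t3, t4]
    ring

theorem peel6 (hs : Sym3 eb) (x : V → ℝ) (hx : ∀ v, 0 ≤ x v) (v1 v2 v3 v4 v5 v6 : V)
    (hnd : [v1, v2, v3, v4, v5, v6].Nodup) :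
    ∃ y : V → ℝ, (∀ v, 0 ≤ y v) ∧
      (∀ v, y v ≠ 0 → v ≠ v1 ∧ v ≠ v2 ∧ v ≠ v3 ∧ v ≠ v4 ∧ v ≠ v5 ∧ v ≠ v6) ∧
      ∑ v, y v = ∑ v, x v - x v1 - x v2 - x v3 - x v4 - x v5 - x v6 ∧
      dF eb x = dF eb y + 3 * (x v1 * qF eb y v1 + x v2 * qF eb y v2 + x v3 * qF eb y v3
          + x v4 * qF eb y v4 + x v5 * qF eb y v5 + x v6 * qF eb y v6)
        + 6 * (x v1 * x v2 * lF eb y v1 v2 + x v1 * x v3 * lF eb y v1 v3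
          + x v1 * x v4 * lF eb y v1 v4 + x v1 * x v5 * lF eb y v1 v5 + x v1 * x v6 * lF eb y v1 v6
          + x v2 * x v3 * lF eb y v2 v3
          + x v2 * x v4 * lF eb y v2 v4 + x v2 * x v5 * lF eb y v2 v5 + x v2 * x v6 * lF eb y v2 v6
          + x v3 * x v4 * lF eb y v3 v4 + x v3 * x v5 * lF eb y v3 v5 + x v3 * x v6 * lF eb y v3 v6
          + x v4 * x v5 * lF eb y v4 v5 + x v4 * x v6 * lF eb y v4 v6
          + x v5 * x v6 * lF eb y v5 v6)
        + 6 * (x v1 * x v2 * (x v3 * ev eb v1 v2 v3 + x v4 * ev eb v1 v2 v4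
            + x v5 * ev eb v1 v2 v5 + x v6 * ev eb v1 v2 v6)
          + x v3 * x v4 * (x v1 * ev eb v1 v3 v4 + x v2 * ev eb v2 v3 v4
            + x v5 * ev eb v3 v4 v5 + x v6 * ev eb v3 v4 v6)
          + x v5 * x v6 * (x v1 * ev eb v1 v5 v6 + x v2 * ev eb v2 v5 v6
            + x v3 * ev eb v3 v5 v6 + x v4 * ev eb v4 v5 v6)
          + x v3 * x v5 * (x v1 * ev eb v1 v3 v5 + x v2 * ev eb v2 v3 v5)
          + x v3 * x v6 * (x v1 * ev eb v1 v3 v6 + x v2 * ev eb v2 v3 v6)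
          + x v4 * x v5 * (x v1 * ev eb v1 v4 v5 + x v2 * ev eb v2 v4 v5)
          + x v4 * x v6 * (x v1 * ev eb v1 v4 v6 + x v2 * ev eb v2 v4 v6)) := by
  simp only [List.nodup_cons, List.mem_cons, List.not_mem_nil, not_or, or_false] at hnd
  obtain ⟨x1, p1, n1, e1, s1, d1, q1, l1⟩ := peel hs x hx v1
  obtain ⟨x2, p2, n2, e2, s2, d2, q2, l2⟩ := peel hs x1 p1 v2
  obtain ⟨x3, p3, n3, e3, s3, d3, q3, l3⟩ := peel hs x2 p2 v3
  obtain ⟨x4, p4, n4, e4, s4, d4, q4, l4⟩ := peel hs x3 p3 v4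
  obtain ⟨x5, p5, n5, e5, s5, d5, q5, l5⟩ := peel hs x4 p4 v5
  obtain ⟨x6, p6, n6, e6, s6, d6, q6, l6⟩ := peel hs x5 p5 v6
  have t2 : x1 v2 = x v2 := e1 _ (by tauto)
  have t3 : x2 v3 = x v3 := by rw [e2 _ (by tauto), e1 _ (by tauto)]
  have t4 : x3 v4 = x v4 := by rw [e3 _ (by tauto), e2 _ (by tauto), e1 _ (by tauto)]
  have t5 : x4 v5 = x v5 := by
    rw [e4 _ (by tauto), e3 _ (by tauto), e2 _ (by tauto), e1 _ (by tauto)]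
  have t6 : x5 v6 = x v6 := by
    rw [e5 _ (by tauto), e4 _ (by tauto), e3 _ (by tauto), e2 _ (by tauto), e1 _ (by tauto)]
  refine ⟨x6, p6, fun v hv => ?_, ?_, ?_⟩
  · have b6 := n6 v hv
    have b5 := n5 v b6.2
    have b4 := n4 v b5.2
    have b3 := n3 v b4.2
    have b2 := n2 v b3.2
    have b1 := n1 v b2.2
    exact ⟨b1.1, b2.1, b3.1, b4.1, b5.1, b6.1⟩
  · rw [s6, s5, s4, s3, s2, s1, t2, t3, t4, t5, t6]
  · rw [d1, d2, d3, d4, d5, d6]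
    simp only [q2, q3, q4, q5, q6, l3, l4, l5, l6, t2, t3, t4, t5, t6]
    ring

theorem MeetK4.no (h : MeetK4 eb) {a b c d : V} (hK : isK4 eb a b c d) {u v w : V}
    (hu : u ≠ a ∧ u ≠ b ∧ u ≠ c ∧ u ≠ d) (hv : v ≠ a ∧ v ≠ b ∧ v ≠ c ∧ v ≠ d)
    (hw : w ≠ a ∧ w ≠ b ∧ w ≠ c ∧ w ≠ d) : eb u v w = false := by
  cases he : eb u v w
  · rfl
  · have := h a b c d hK u v w he
    simp only [mem_insert, mem_singleton] at this
    tauto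

theorem exists_s (y : V → ℝ) (hy : ∀ v, 0 ≤ y v) (a b : V) :
    ∃ s : ℝ, (s = 0 ∨ s = 1) ∧ lF eb y a b ≤ (∑ w, y w) * s ∧
      (s = 1 → ∃ u, y u ≠ 0 ∧ eb a b u = true) := by
  by_cases h : ∃ u, y u ≠ 0 ∧ eb a b u = true
  · exact ⟨1, Or.inr rfl, by simpa using l_le y hy a b, fun _ => h⟩
  · refine ⟨0, Or.inl rfl, ?_, by simp⟩
    rw [l_zero y a b]
    · simp
    · intro w hw
      by_contra hc
      exact h ⟨w, hw, by simpa using hc⟩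

theorem cross_le (hst : MeetK4 eb) {p q : ℝ} (hp : 0 ≤ p) (hpq : q ≤ p) (hq : 0 ≤ q) {v1 v2 a b a' b' : V}
    (h1 : eb v1 v2 a = true) (h2 : eb v1 v2 b = true) (y : V → ℝ)
    (hy : ∀ v, y v ≠ 0 → v ≠ v1 ∧ v ≠ v2 ∧ v ≠ a ∧ v ≠ b)
    (ha' : a' ≠ v1 ∧ a' ≠ v2 ∧ a' ≠ a ∧ a' ≠ b) (hb' : b' ≠ v1 ∧ b' ≠ v2 ∧ b' ≠ a ∧ b' ≠ b)
    {s : ℝ} (hs : s = 0 ∨ s = 1) (hs1 : s = 1 → ∃ u, y u ≠ 0 ∧ eb a' b' u = true) :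
    p * ev eb v1 a b + q * ev eb v2 a b ≤ p + q - q * s := by
  have g1 := mul_le_mul_of_nonneg_left (ev_le_one (eb := eb) v1 a b) hp
  have g2 := mul_le_mul_of_nonneg_left (ev_le_one (eb := eb) v2 a b) hq
  rcases hs with h | h
  · rw [h]; linarith
  · obtain ⟨u, hu, he⟩ := hs1 h
    rw [h]
    cases c1 : eb v1 a b
    · rw [ev_zero c1]; linarith
    · cases c2 : eb v2 a b
      · rw [ev_zero c2]; linarith
      · have := hst.no ⟨h1, h2, c1, c2⟩ ha' hb' (hy u hu)
        rw [this] at he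
        cases he

end


section
variable {V : Type*} [Fintype V] [DecidableEq V] {eb : V → V → V → Bool}

set_option maxHeartbeats 4000000 in
theorem case2ii_aux (hs : Sym3 eb) (hst : MeetK4 eb) (x : V → ℝ) (hx : ∀ v, 0 ≤ x v)
    (hsum : ∑ v, x v = 1) (v1 v2 v3 v4 v5 v6 : V) (hnd : [v1, v2, v3, v4, v5, v6].Nodup)
    (hK : isK4 eb v1 v2 v3 v4) (hK' : isK4 eb v1 v2 v5 v6)
    (hno : ∀ u w, u ∉ [v1, v2, v3, v4, v5, v6] → w ∉ [v1, v2, v3, v4, v5, v6] →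
      ¬ isK4 eb v1 v2 u w) (hle : x v2 ≤ x v1) : dF eb x ≤ 5772 / 10000 := by
  obtain ⟨y, hy, off, hr, hd⟩ := peel6 hs x hx v1 v2 v3 v4 v5 v6 hnd
  simp only [List.nodup_cons, List.mem_cons, List.not_mem_nil, not_or, or_false] at hnd hno
  obtain ⟨r, hrd⟩ : ∃ r, r = ∑ v, y v := ⟨_, rfl⟩
  have hr0 : 0 ≤ r := hrd ▸ sum_nonneg fun v _ => hy v
  have z0 : dF eb y = 0 := d_zero y fun c u w hc hu hw => by
    have := off c hc; have := off u hu; have := off w hw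
    exact hst.no hK (by tauto) (by tauto) (by tauto)
  have z3 : qF eb y v3 = 0 := q_zero y _ fun u w hu hw => by
    have := off u hu; have := off w hw
    exact hst.no hK' (by grind) (by tauto) (by tauto)
  have z4 : qF eb y v4 = 0 := q_zero y _ fun u w hu hw => by
    have := off u hu; have := off w hw
    exact hst.no hK' (by grind) (by tauto) (by tauto)
  have z5 : qF eb y v5 = 0 := q_zero y _ fun u w hu hw => by
    have := off u hu; have := off w hw
    exact hst.no hK (by grind) (by tauto) (by tauto)
  have z6 : qF eb y v6 = 0 := q_zero y _ fun u w hu hw => by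
    have := off u hu; have := off w hw
    exact hst.no hK (by grind) (by tauto) (by tauto)
  have z34 : lF eb y v3 v4 = 0 := l_zero y _ _ fun u hu => by
    have := off u hu
    exact hst.no hK' (by grind) (by grind) (by tauto)
  have z56 : lF eb y v5 v6 = 0 := l_zero y _ _ fun u hu => by
    have := off u hu
    exact hst.no hK (by grind) (by grind) (by tauto)
  have h1 := hx v1
  have h2 := hx v2
  have h3 := hx v3
  have h4 := hx v4
  have h5 := hx v5
  have h6 := hx v6
  -- the quadratic terms
  have B12 : x v1 * qF eb y v1 + x v2 * qF eb y v2 ≤ (x v1 + x v2) * r^2 - x v2 * (lF eb y v1 v2)^2 := by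
    have e1 : (x v1 + x v2) * r^2 - x v2 * (lF eb y v1 v2)^2 =
        ∑ u, ∑ w, y u * y w * (x v1 + x v2 - x v2 * (ev eb v1 v2 u * ev eb v1 v2 w)) := by
      rw [hrd, ← sum_mul_two, sq, lF, sum_mul_sum]
      simp_rw [mul_sum]
      rw [← sum_sub_distrib]
      refine sum_congr rfl fun u _ => ?_
      rw [← sum_sub_distrib]
      exact sum_congr rfl fun w _ => by ring
    have e2 : x v1 * qF eb y v1 + x v2 * qF eb y v2 =
        ∑ u, ∑ w, y u * y w * (x v1 * ev eb v1 u w + x v2 * ev eb v2 u w) := by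
      rw [q_eq, q_eq]
      simp_rw [mul_sum]
      rw [← sum_add_distrib]
      refine sum_congr rfl fun u _ => ?_
      rw [← sum_add_distrib]
      exact sum_congr rfl fun w _ => by ring
    rw [e1, e2]
    refine sum_le_sum fun u _ => sum_le_sum fun w _ => ?_
    by_cases hu : y u = 0
    · simp [hu]
    by_cases hw : y w = 0
    · simp [hw]
    refine mul_le_mul_of_nonneg_left ?_ (mul_nonneg (hy u) (hy w))
    have n := hno u w (by have := off u hu; tauto) (by have := off w hw; tauto)
    rw [isK4] at n
    cases c1 : eb v1 v2 u <;> cases c2 : eb v1 v2 w <;> cases c3 : eb v1 u w <;> cases c4 : eb v2 u w <;>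
      first
      | (exfalso; exact n ⟨c1, c2, c3, c4⟩)
      | (simp only [ev, bI, c1, c2, c3, c4]; norm_num; try linarith)
  obtain ⟨s35, hs35, l35, t35⟩ := exists_s (eb := eb) y hy v3 v5
  obtain ⟨s36, hs36, l36, t36⟩ := exists_s (eb := eb) y hy v3 v6
  obtain ⟨s45, hs45, l45, t45⟩ := exists_s (eb := eb) y hy v4 v5
  obtain ⟨s46, hs46, l46, t46⟩ := exists_s (eb := eb) y hy v4 v6
  rw [← hrd] at l35 l36 l45 l46
  have c35 := cross_le hst h1 hle h2 hK.1 hK'.1 y (fun v hv => by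
    obtain ⟨o1, o2, o3, o4, o5, o6⟩ := off v hv; exact ⟨o1, o2, o3, o5⟩)
    (a' := v4) (b' := v6) (by grind) (by grind) hs46 t46
  have c36 := cross_le hst h1 hle h2 hK.1 hK'.2.1 y (fun v hv => by
    obtain ⟨o1, o2, o3, o4, o5, o6⟩ := off v hv; exact ⟨o1, o2, o3, o6⟩)
    (a' := v4) (b' := v5) (by grind) (by grind) hs45 t45
  have c45 := cross_le hst h1 hle h2 hK.2.1 hK'.1 y (fun v hv => by
    obtain ⟨o1, o2, o3, o4, o5, o6⟩ := off v hv; exact ⟨o1, o2, o4, o5⟩)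
    (a' := v3) (b' := v6) (by grind) (by grind) hs36 t36
  have c46 := cross_le hst h1 hle h2 hK.2.1 hK'.2.1 y (fun v hv => by
    obtain ⟨o1, o2, o3, o4, o5, o6⟩ := off v hv; exact ⟨o1, o2, o4, o6⟩)
    (a' := v3) (b' := v5) (by grind) (by grind) hs35 t35
  have hq := l_nonneg (eb := eb) y hy v1 v2
  have hl : ∀ a b, lF eb y a b ≤ r := fun a b => hrd ▸ l_le y hy a b
  have N := num_2ii (x v1) (x v2) r (lF eb y v1 v2) (x v3) (x v4) (x v5) (x v6) s35 s36 s45 s46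
    h2 hle hr0 hq (hl _ _) h3 h4 h5 h6 (by rw [← hrd, hsum] at hr; linarith) hs35 hs36 hs45 hs46
  have M : ∀ i j a b c, x i * x j * (x a * ev eb a b c) ≤ x i * x j * x a := fun i j a b c =>
    mul_le_mul_of_nonneg_left (mul_le_of_le_one_right (hx _) (ev_le_one _ _ _)) (mul_nonneg (hx _) (hx _))
  have M' : ∀ i j k a b c, x i * x j * (x k * ev eb a b c) ≤ x i * x j * x k := fun i j k a b c =>
    mul_le_mul_of_nonneg_left (mul_le_of_le_one_right (hx _) (ev_le_one _ _ _)) (mul_nonneg (hx _) (hx _))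
  have ML : ∀ i j, x i * x j * lF eb y i j ≤ x i * x j * r := fun i j =>
    mul_le_mul_of_nonneg_left (hl _ _) (mul_nonneg (hx _) (hx _))
  rw [hd, z0, z3, z4, z5, z6, z34, z56]
  have g35 := mul_le_mul_of_nonneg_left c35 (mul_nonneg h3 h5)
  have g36 := mul_le_mul_of_nonneg_left c36 (mul_nonneg h3 h6)
  have g45 := mul_le_mul_of_nonneg_left c45 (mul_nonneg h4 h5)
  have g46 := mul_le_mul_of_nonneg_left c46 (mul_nonneg h4 h6)
  have k35 := mul_le_mul_of_nonneg_left l35 (mul_nonneg h3 h5)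
  have k36 := mul_le_mul_of_nonneg_left l36 (mul_nonneg h3 h6)
  have k45 := mul_le_mul_of_nonneg_left l45 (mul_nonneg h4 h5)
  have k46 := mul_le_mul_of_nonneg_left l46 (mul_nonneg h4 h6)
  linarith [M' v1 v2 v3 v1 v2 v3, M' v1 v2 v4 v1 v2 v4, M' v1 v2 v5 v1 v2 v5, M' v1 v2 v6 v1 v2 v6,
    M' v3 v4 v1 v1 v3 v4, M' v3 v4 v2 v2 v3 v4, M' v3 v4 v5 v3 v4 v5, M' v3 v4 v6 v3 v4 v6,
    M' v5 v6 v1 v1 v5 v6, M' v5 v6 v2 v2 v5 v6, M' v5 v6 v3 v3 v5 v6, M' v5 v6 v4 v4 v5 v6,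
    ML v1 v3, ML v1 v4, ML v1 v5, ML v1 v6, ML v2 v3, ML v2 v4, ML v2 v5, ML v2 v6]
end


section
variable {V : Type*} [Fintype V] [DecidableEq V] {eb : V → V → V → Bool}

theorem isK4.swap12 (hs : Sym3 eb) {a b c d : V} (h : isK4 eb a b c d) : isK4 eb b a c d :=
  ⟨by rw [hs.h12]; exact h.1, by rw [hs.h12]; exact h.2.1, h.2.2.2, h.2.2.1⟩
theorem isK4.swap23 (hs : Sym3 eb) {a b c d : V} (h : isK4 eb a b c d) : isK4 eb a c b d :=
  ⟨by rw [hs.h23]; exact h.1, h.2.2.1, h.2.1, by rw [hs.h12]; exact h.2.2.2⟩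
theorem isK4.swap34 (hs : Sym3 eb) {a b c d : V} (h : isK4 eb a b c d) : isK4 eb a b d c :=
  ⟨h.2.1, h.1, by rw [hs.h23]; exact h.2.2.1, by rw [hs.h23]; exact h.2.2.2⟩

theorem case2ii (hs : Sym3 eb) (hst : MeetK4 eb) (x : V → ℝ) (hx : ∀ v, 0 ≤ x v)
    (hsum : ∑ v, x v = 1) (v1 v2 v3 v4 v5 v6 : V) (hnd : [v1, v2, v3, v4, v5, v6].Nodup)
    (hK : isK4 eb v1 v2 v3 v4) (hK' : isK4 eb v1 v2 v5 v6)
    (hno : ∀ u w, u ∉ [v1, v2, v3, v4, v5, v6] → w ∉ [v1, v2, v3, v4, v5, v6] →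
      ¬ isK4 eb v1 v2 u w) : dF eb x ≤ 5772 / 10000 := by
  rcases le_total (x v2) (x v1) with h | h
  · exact case2ii_aux hs hst x hx hsum v1 v2 v3 v4 v5 v6 hnd hK hK' hno h
  · refine case2ii_aux hs hst x hx hsum v2 v1 v3 v4 v5 v6 (by grind) (hK.swap12 hs) (hK'.swap12 hs)
      (fun u w hu hw hc => hno u w (by grind) (by grind) (hc.swap12 hs)) h

theorem avg_bound (y : V → ℝ) (hy : ∀ v, 0 ≤ y v) (P : V → ℝ) (L : V → V → ℝ) (r C : ℝ)
    (hr : r = ∑ v, y v)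
    (h : ∀ u v, y u ≠ 0 → y v ≠ 0 → P u + P v + r * L u v ≤ C) :
    2 * r * (∑ u, y u * P u) + r * (∑ u, ∑ v, y u * y v * L u v) ≤ C * r ^ 2 := by
  have e1 : r * (∑ u, y u * P u) = ∑ u, ∑ v, y u * y v * P u := by
    rw [mul_sum, hr]
    refine sum_congr rfl fun u _ => ?_
    rw [sum_mul]
    exact sum_congr rfl fun v _ => by ring
  have e2 : r * (∑ u, y u * P u) = ∑ u, ∑ v, y u * y v * P v := by
    rw [hr, sum_mul_sum]
    exact sum_congr rfl fun v _ => sum_congr rfl fun u _ => by ring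
  have e3 : C * r ^ 2 = ∑ u, ∑ v, y u * y v * C := by
    rw [hr, ← sum_mul_two]
    simp_rw [mul_sum]
    exact sum_congr rfl fun v _ => sum_congr rfl fun u _ => by ring
  have e4 : r * (∑ u, ∑ v, y u * y v * L u v) = ∑ u, ∑ v, y u * y v * (r * L u v) := by
    simp_rw [mul_sum]
    exact sum_congr rfl fun v _ => sum_congr rfl fun u _ => by ring
  have : 2 * r * (∑ u, y u * P u) + r * (∑ u, ∑ v, y u * y v * L u v)
      = ∑ u, ∑ v, y u * y v * (P u + P v + r * L u v) := by
    rw [show 2 * r * (∑ u, y u * P u) = r * (∑ u, y u * P u) + r * (∑ u, y u * P u) by ring]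
    nth_rewrite 1 [e1]
    rw [e2, e4, ← sum_add_distrib, ← sum_add_distrib]
    refine sum_congr rfl fun u _ => ?_
    rw [← sum_add_distrib, ← sum_add_distrib]
    exact sum_congr rfl fun v _ => by ring
  rw [this, e3]
  refine sum_le_sum fun u _ => sum_le_sum fun w _ => ?_
  by_cases hu : y u = 0
  · simp [hu]
  by_cases hw : y w = 0
  · simp [hw]
  exact mul_le_mul_of_nonneg_left (h u w hu hw) (mul_nonneg (hy u) (hy w))

theorem pair_bound {i j u v : V} (h : ¬ isK4 eb i j u v) (p : ℝ) (hp : 0 ≤ p) :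
    p * ev eb i j u + p * ev eb i j v ≤ 2 * p - p * (ev eb i u v * ev eb j u v) := by
  rw [isK4] at h
  cases c1 : eb i j u <;> cases c2 : eb i j v <;> cases c3 : eb i u v <;> cases c4 : eb j u v <;>
    first
    | (exfalso; exact h ⟨c1, c2, c3, c4⟩)
    | (simp only [ev, bI, c1, c2, c3, c4]; norm_num; try linarith)

theorem nm4 {u a b c d : V} (h1 : u ≠ a) (h2 : u ≠ b) (h3 : u ≠ c) (h4 : u ≠ d) :
    u ∉ [a, b, c, d] := by simp [h1, h2, h3, h4]

theorem case1 (hs : Sym3 eb) (hst : MeetK4 eb) (x : V → ℝ) (hx : ∀ v, 0 ≤ x v)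
    (hsum : ∑ v, x v = 1) (v1 v2 v3 v4 : V) (hK : isK4 eb v1 v2 v3 v4)
    (hno : ∀ i j k l u w, isK4 eb i j k l → isK4 eb i j u w → u ∉ [i, j, k, l] →
      w ∉ [i, j, k, l] → False) : dF eb x ≤ 5772 / 10000 := by
  have hnd : [v1, v2, v3, v4].Nodup := by
    have a1 := hs.ne hK.1
    have a2 := hs.ne hK.2.1
    have a3 := hs.ne hK.2.2.1
    simp; tauto
  obtain ⟨y, hy, off, hr, hd⟩ := peel4 hs x hx v1 v2 v3 v4 hnd
  rw [ev_one hK.1, ev_one hK.2.1, ev_one hK.2.2.1, ev_one hK.2.2.2] at hd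
  obtain ⟨r, hrd⟩ : ∃ r, r = ∑ v, y v := ⟨_, rfl⟩
  have hr0 : 0 ≤ r := hrd ▸ sum_nonneg fun v _ => hy v
  have z0 : dF eb y = 0 := d_zero y fun c u w hc hu hw =>
    hst.no hK (off c hc) (off u hu) (off w hw)
  rw [← hrd, hsum] at hr
  have n12 : ∀ u w, y u ≠ 0 → y w ≠ 0 → ¬ isK4 eb v1 v2 u w := fun u w hu hw hc =>
    hno v1 v2 v3 v4 u w hK hc (nm4 (off u hu).1 (off u hu).2.1 (off u hu).2.2.1 (off u hu).2.2.2) (nm4 (off w hw).1 (off w hw).2.1 (off w hw).2.2.1 (off w hw).2.2.2)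
  have n13 : ∀ u w, y u ≠ 0 → y w ≠ 0 → ¬ isK4 eb v1 v3 u w := fun u w hu hw hc =>
    hno v1 v3 v2 v4 u w (hK.swap23 hs) hc
      (nm4 (off u hu).1 (off u hu).2.2.1 (off u hu).2.1 (off u hu).2.2.2) (nm4 (off w hw).1 (off w hw).2.2.1 (off w hw).2.1 (off w hw).2.2.2)
  have n14 : ∀ u w, y u ≠ 0 → y w ≠ 0 → ¬ isK4 eb v1 v4 u w := fun u w hu hw hc =>
    hno v1 v4 v2 v3 u w ((hK.swap34 hs).swap23 hs) hc
      (nm4 (off u hu).1 (off u hu).2.2.2 (off u hu).2.1 (off u hu).2.2.1) (nm4 (off w hw).1 (off w hw).2.2.2 (off w hw).2.1 (off w hw).2.2.1)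
  have n23 : ∀ u w, y u ≠ 0 → y w ≠ 0 → ¬ isK4 eb v2 v3 u w := fun u w hu hw hc =>
    hno v2 v3 v1 v4 u w ((hK.swap12 hs).swap23 hs) hc
      (nm4 (off u hu).2.1 (off u hu).2.2.1 (off u hu).1 (off u hu).2.2.2) (nm4 (off w hw).2.1 (off w hw).2.2.1 (off w hw).1 (off w hw).2.2.2)
  have n24 : ∀ u w, y u ≠ 0 → y w ≠ 0 → ¬ isK4 eb v2 v4 u w := fun u w hu hw hc =>
    hno v2 v4 v1 v3 u w (((hK.swap12 hs).swap34 hs).swap23 hs) hc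
      (nm4 (off u hu).2.1 (off u hu).2.2.2 (off u hu).1 (off u hu).2.2.1) (nm4 (off w hw).2.1 (off w hw).2.2.2 (off w hw).1 (off w hw).2.2.1)
  have n34 : ∀ u w, y u ≠ 0 → y w ≠ 0 → ¬ isK4 eb v3 v4 u w := fun u w hu hw hc =>
    hno v3 v4 v1 v2 u w ((((hK.swap23 hs).swap12 hs).swap34 hs).swap23 hs) hc
      (nm4 (off u hu).2.2.1 (off u hu).2.2.2 (off u hu).1 (off u hu).2.1) (nm4 (off w hw).2.2.1 (off w hw).2.2.2 (off w hw).1 (off w hw).2.1)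
  have h1 := hx v1
  have h2 := hx v2
  have h3 := hx v3
  have h4 := hx v4
  have E2 := num_e2 (x v1) (x v2) (x v3) (x v4)
  have E3 := num_e3 (x v1) (x v2) (x v3) (x v4) h1 h2 h3 h4
  have key : ∀ M : ℝ, (∀ u v, r * (x v1 * ev eb v1 u v + x v2 * ev eb v2 u v + x v3 * ev eb v3 u v
        + x v4 * ev eb v4 u v) - (x v1 * x v2 * (ev eb v1 u v * ev eb v2 u v)
        + x v1 * x v3 * (ev eb v1 u v * ev eb v3 u v) + x v1 * x v4 * (ev eb v1 u v * ev eb v4 u v)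
        + x v2 * x v3 * (ev eb v2 u v * ev eb v3 u v) + x v2 * x v4 * (ev eb v2 u v * ev eb v4 u v)
        + x v3 * x v4 * (ev eb v3 u v * ev eb v4 u v)) ≤ M) →
      r * dF eb x ≤ r * (6 * (x v1 * x v2 * x v3 + x v1 * x v2 * x v4 + x v1 * x v3 * x v4
        + x v2 * x v3 * x v4) + 3 * r * (2 * (x v1 * x v2 + x v1 * x v3 + x v1 * x v4 + x v2 * x v3
        + x v2 * x v4 + x v3 * x v4) + M)) := by
    intro M hM
    have A := avg_bound y hy (fun u => x v1 * x v2 * ev eb v1 v2 u + x v1 * x v3 * ev eb v1 v3 u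
      + x v1 * x v4 * ev eb v1 v4 u + x v2 * x v3 * ev eb v2 v3 u + x v2 * x v4 * ev eb v2 v4 u
      + x v3 * x v4 * ev eb v3 v4 u) (fun u v => x v1 * ev eb v1 u v + x v2 * ev eb v2 u v
      + x v3 * ev eb v3 u v + x v4 * ev eb v4 u v) r (2 * (x v1 * x v2 + x v1 * x v3 + x v1 * x v4
      + x v2 * x v3 + x v2 * x v4 + x v3 * x v4) + M) hrd (by
        intro u w hu hw
        have b12 := pair_bound (n12 u w hu hw) (x v1 * x v2) (mul_nonneg h1 h2)
        have b13 := pair_bound (n13 u w hu hw) (x v1 * x v3) (mul_nonneg h1 h3)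
        have b14 := pair_bound (n14 u w hu hw) (x v1 * x v4) (mul_nonneg h1 h4)
        have b23 := pair_bound (n23 u w hu hw) (x v2 * x v3) (mul_nonneg h2 h3)
        have b24 := pair_bound (n24 u w hu hw) (x v2 * x v4) (mul_nonneg h2 h4)
        have b34 := pair_bound (n34 u w hu hw) (x v3 * x v4) (mul_nonneg h3 h4)
        have := hM u w
        linarith)
    have f1 : ∑ u, y u * (x v1 * x v2 * ev eb v1 v2 u + x v1 * x v3 * ev eb v1 v3 u
      + x v1 * x v4 * ev eb v1 v4 u + x v2 * x v3 * ev eb v2 v3 u + x v2 * x v4 * ev eb v2 v4 u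
      + x v3 * x v4 * ev eb v3 v4 u) = x v1 * x v2 * lF eb y v1 v2 + x v1 * x v3 * lF eb y v1 v3
          + x v1 * x v4 * lF eb y v1 v4 + x v2 * x v3 * lF eb y v2 v3
          + x v2 * x v4 * lF eb y v2 v4 + x v3 * x v4 * lF eb y v3 v4 := by
      simp only [lF, mul_sum, ← sum_add_distrib]
      exact sum_congr rfl fun u _ => by ring
    have f2 : ∑ u, ∑ v, y u * y v * (x v1 * ev eb v1 u v + x v2 * ev eb v2 u v
      + x v3 * ev eb v3 u v + x v4 * ev eb v4 u v) = x v1 * qF eb y v1 + x v2 * qF eb y v2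
      + x v3 * qF eb y v3 + x v4 * qF eb y v4 := by
      simp only [q_eq, mul_sum, ← sum_add_distrib]
      exact sum_congr rfl fun u _ => sum_congr rfl fun u _ => by ring
    rw [f1, f2] at A
    rw [hd, z0]
    linarith
  rcases hr0.eq_or_lt with h0 | hpos
  · have hy0 : ∀ v, y v = 0 := by
      rw [← h0] at hrd
      intro v
      exact (sum_eq_zero_iff_of_nonneg fun v _ => hy v).1 hrd.symm v (mem_univ _)
    have ql : ∀ a, qF eb y a = 0 := fun a => q_zero y a fun u w hu _ => absurd (hy0 u) hu
    have ll : ∀ a b, lF eb y a b = 0 := fun a b => l_zero y a b fun u hu => absurd (hy0 u) hu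
    rw [hd, z0]
    simp only [ql, ll]
    rw [show x v1 + x v2 + x v3 + x v4 = 1 by linarith] at E3
    linarith
  obtain ⟨s, hsd⟩ : ∃ s, s = x v1 + x v2 + x v3 + x v4 := ⟨_, rfl⟩
  rw [← hsd] at E2 E3
  have hrs : r = 1 - s := by linarith
  have E2' := mul_le_mul_of_nonneg_left E2 (show 0 ≤ 3 * r by linarith)
  rcases le_total s (1/2) with h | h
  · have K := key _ fun u v => num_pa r (x v1) (x v2) (x v3) (x v4) _ _ _ _ h1 h2 h3 h4
      (by linarith) (ev_cases _ _ _ _) (ev_cases _ _ _ _) (ev_cases _ _ _ _) (ev_cases _ _ _ _)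
    have K := le_of_mul_le_mul_left K hpos
    have N := num_1a s (by linarith) h
    rw [← hsd] at K
    rw [← hrs] at N
    linarith
  · have K := key _ fun u v => num_pb r (x v1) (x v2) (x v3) (x v4) _ _ _ _
      (ev_cases _ _ _ _) (ev_cases _ _ _ _) (ev_cases _ _ _ _) (ev_cases _ _ _ _)
    have K := le_of_mul_le_mul_left K hpos
    have N := num_1b s h (by linarith)
    rw [← hsd] at K
    rw [← hrs] at N
    linarith
end


section
variable {V : Type*} [Fintype V] [DecidableEq V] {eb : V → V → V → Bool}

theorem sum_two (y : V → ℝ) {a b : V} (hab : a ≠ b) :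
    ∑ w, y w * (if w = a ∨ w = b then (1:ℝ) else 0) = y a + y b := by
  have : ∀ w, y w * (if w = a ∨ w = b then (1:ℝ) else 0)
      = (if w = a then y a else 0) + (if w = b then y b else 0) := by
    intro w
    by_cases h1 : w = a
    · subst h1; simp [hab]
    · by_cases h2 : w = b
      · subst h2; simp [h1]
      · simp [h1, h2]
  rw [sum_congr rfl fun w _ => this w, sum_add_distrib]
  simp

theorem q_diag (hs : Sym3 eb) (y : V → ℝ) (hy : ∀ v, 0 ≤ y v) (a : V) :
    qF eb y a ≤ (∑ v, y v)^2 - ∑ v, y v ^ 2 := by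
  rw [q_eq, ← sum_mul_two, ← sum_sub_distrib]
  refine sum_le_sum fun u _ => ?_
  have : y u ^ 2 = ∑ v, if v = u then y u ^ 2 else 0 := by simp
  rw [this, ← sum_sub_distrib]
  refine sum_le_sum fun v _ => ?_
  by_cases h : v = u
  · subst h
    rw [ev_zero (hs.irr23 a v)]; simp [sq]
  · simp only [h, if_false, sub_zero]
    exact mul_le_of_le_one_right (mul_nonneg (hy u) (hy v)) (ev_le_one _ _ _)

theorem triple_prod (y a b c : V → ℝ) : ∑ p, ∑ q, ∑ r, y p * y q * y r * (a p * b q * c r)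
    = (∑ p, y p * a p) * (∑ p, y p * b p) * (∑ p, y p * c p) := by
  rw [sum_mul_sum, sum_mul]
  refine sum_congr rfl fun p _ => ?_
  rw [sum_mul]
  refine sum_congr rfl fun q _ => ?_
  rw [mul_sum]
  exact sum_congr rfl fun r _ => by ring

theorem d_trans (y : V → ℝ) (hy : ∀ v, 0 ≤ y v) (a b c : V → ℝ)
    (h : ∀ p q r, y p ≠ 0 → y q ≠ 0 → y r ≠ 0 → ev eb p q r ≤ a p * b q * c r + a p * c q * b r
      + b p * a q * c r + b p * c q * a r + c p * a q * b r + c p * b q * a r) :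
    dF eb y ≤ 6 * (∑ p, y p * a p) * (∑ p, y p * b p) * (∑ p, y p * c p) := by
  have e : 6 * (∑ p, y p * a p) * (∑ p, y p * b p) * (∑ p, y p * c p) =
      ∑ p, ∑ q, ∑ r, y p * y q * y r * (a p * b q * c r + a p * c q * b r
      + b p * a q * c r + b p * c q * a r + c p * a q * b r + c p * b q * a r) := by
    simp only [mul_add, sum_add_distrib, triple_prod]
    ring
  rw [e, d_eq]
  refine sum_le_sum fun p _ => sum_le_sum fun q _ => sum_le_sum fun r _ => ?_
  by_cases hp : y p = 0
  · simp [hp]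
  by_cases hq : y q = 0
  · simp [hq]
  by_cases hr : y r = 0
  · simp [hr]
  exact mul_le_mul_of_nonneg_left (h p q r hp hq hr) (mul_nonneg (mul_nonneg (hy p) (hy q)) (hy r))

theorem perm6 (p q r : V) (A B C : V → Prop) [DecidablePred A] [DecidablePred B] [DecidablePred C]
    (hA : A p ∨ A q ∨ A r) (hB : B p ∨ B q ∨ B r) (hC : C p ∨ C q ∨ C r)
    (hAB : ∀ v, A v → ¬ B v) (hAC : ∀ v, A v → ¬ C v) (hBC : ∀ v, B v → ¬ C v) :
    let a : V → ℝ := fun v => if A v then 1 else 0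
    let b : V → ℝ := fun v => if B v then 1 else 0
    let c : V → ℝ := fun v => if C v then 1 else 0
    (1:ℝ) ≤ a p * b q * c r + a p * c q * b r
      + b p * a q * c r + b p * c q * a r + c p * a q * b r + c p * b q * a r := by
  intro a b c
  have na : ∀ v, 0 ≤ a v := fun v => by simp only [a]; split_ifs <;> norm_num
  have nb : ∀ v, 0 ≤ b v := fun v => by simp only [b]; split_ifs <;> norm_num
  have nc : ∀ v, 0 ≤ c v := fun v => by simp only [c]; split_ifs <;> norm_num
  have t1 := mul_nonneg (mul_nonneg (na p) (nb q)) (nc r)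
  have t2 := mul_nonneg (mul_nonneg (na p) (nc q)) (nb r)
  have t3 := mul_nonneg (mul_nonneg (nb p) (na q)) (nc r)
  have t4 := mul_nonneg (mul_nonneg (nb p) (nc q)) (na r)
  have t5 := mul_nonneg (mul_nonneg (nc p) (na q)) (nb r)
  have t6 := mul_nonneg (mul_nonneg (nc p) (nb q)) (na r)
  have ea : ∀ v, A v → a v = 1 := fun v h => if_pos h
  have eb : ∀ v, B v → b v = 1 := fun v h => if_pos h
  have ec : ∀ v, C v → c v = 1 := fun v h => if_pos h
  rcases hA with h | h | h <;> rcases hB with g | g | g <;> rcases hC with k | k | k <;>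
    first
    | exact absurd g (hAB _ h)
    | exact absurd k (hAC _ h)
    | exact absurd k (hBC _ g)
    | (rw [ea _ h, eb _ g, ec _ k] at *; linarith)

theorem case2i (hs : Sym3 eb) (hst : MeetK4 eb) (x : V → ℝ) (hx : ∀ v, 0 ≤ x v)
    (hsum : ∑ v, x v = 1) (v1 v2 v3 v4 v5 v6 v7 v8 : V)
    (hnd : [v1, v2, v3, v4, v5, v6, v7, v8].Nodup)
    (hK : isK4 eb v1 v2 v3 v4) (hK' : isK4 eb v1 v2 v5 v6) (hK'' : isK4 eb v1 v2 v7 v8) :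
    dF eb x ≤ √3 / 3 := by
  obtain ⟨y, hy, off, hxy, hr, hd⟩ := peel2 hs x hx v1 v2 (by simp at hnd ⊢; tauto)
  have n34 : v3 ≠ v4 := by grind
  have n56 : v5 ≠ v6 := by grind
  have n78 : v7 ≠ v8 := by grind
  have d1 : ∀ v, (v = v3 ∨ v = v4) → ¬ (v = v5 ∨ v = v6) := by
    clear hd hr hxy off; grind
  have d2 : ∀ v, (v = v3 ∨ v = v4) → ¬ (v = v7 ∨ v = v8) := by
    clear hd hr hxy off; grind
  have d3 : ∀ v, (v = v5 ∨ v = v6) → ¬ (v = v7 ∨ v = v8) := by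
    clear hd hr hxy off; grind
  have D := d_trans (eb := eb) y hy (fun v => if v = v3 ∨ v = v4 then 1 else 0)
    (fun v => if v = v5 ∨ v = v6 then 1 else 0) (fun v => if v = v7 ∨ v = v8 then 1 else 0) (by
      intro p q r hp hq hr
      cases he : eb p q r
      · rw [ev_zero he]
        have : ∀ (P : Prop) [Decidable P], (0:ℝ) ≤ if P then 1 else 0 := fun P _ => by
          split_ifs <;> norm_num
        have g := fun p q r => mul_nonneg (mul_nonneg (this (p = v3 ∨ p = v4)) (this (q = v5 ∨ q = v6)))
          (this (r = v7 ∨ r = v8))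
        linarith [g p q r, g p r q, g q p r, g q r p, g r p q, g r q p]
      · rw [ev_one he]
        have m1 := hst _ _ _ _ hK _ _ _ he
        have m2 := hst _ _ _ _ hK' _ _ _ he
        have m3 := hst _ _ _ _ hK'' _ _ _ he
        have o1 := off p hp
        have o2 := off q hq
        have o3 := off r hr
        simp only [mem_insert, mem_singleton, o1.1, o1.2, o2.1, o2.2, o3.1, o3.2, false_or]
          at m1 m2 m3
        exact perm6 p q r (fun v => v = v3 ∨ v = v4) (fun v => v = v5 ∨ v = v6)
          (fun v => v = v7 ∨ v = v8) m1 m2 m3 d1 d2 d3)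
  have S : ∑ v ∈ ({v3, v4, v5, v6, v7, v8} : Finset V), y v ≤ ∑ v, y v :=
    sum_le_sum_of_subset_of_nonneg (subset_univ _) fun v _ _ => hy v
  have S2 : ∑ v ∈ ({v3, v4, v5, v6, v7, v8} : Finset V), y v ^ 2 ≤ ∑ v, y v ^ 2 :=
    sum_le_sum_of_subset_of_nonneg (subset_univ _) fun v _ _ => sq_nonneg _
  have hnd' : v3 ∉ ({v4, v5, v6, v7, v8} : Finset V) ∧ v4 ∉ ({v5, v6, v7, v8} : Finset V) ∧
      v5 ∉ ({v6, v7, v8} : Finset V) ∧ v6 ∉ ({v7, v8} : Finset V) ∧ v7 ∉ ({v8} : Finset V) := by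
    simp at hnd ⊢; tauto
  obtain ⟨a1, a2, a3, a4, a5⟩ := hnd'
  rw [sum_insert a1, sum_insert a2, sum_insert a3, sum_insert a4, sum_insert a5, sum_singleton]
    at S S2
  simp only [sum_two y n34, sum_two y n56, sum_two y n78] at D
  have q1 := q_diag hs y hy v1
  have q2 := q_diag hs y hy v2
  have l := l_le (eb := eb) y hy v1 v2
  have hc : ∑ v, y v = 1 - x v1 - x v2 := by rw [hr, hsum]
  rw [hc] at q1 q2 l S
  have N := num_2i (x v1) (x v2) (y v3 + y v4) (y v5 + y v6) (y v7 + y v8) (hx _) (hx _)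
    (add_nonneg (hy _) (hy _)) (add_nonneg (hy _) (hy _)) (add_nonneg (hy _) (hy _)) (by linarith)
  have Q : ((y v3 + y v4)^2 + (y v5 + y v6)^2 + (y v7 + y v8)^2) / 2 ≤ ∑ v, y v ^ 2 := by
    linarith [sq_nonneg (y v3 - y v4), sq_nonneg (y v5 - y v6), sq_nonneg (y v7 - y v8)]
  have g1 := mul_le_mul_of_nonneg_left (q1.trans (sub_le_sub_left Q _)) (hx v1)
  have g2 := mul_le_mul_of_nonneg_left (q2.trans (sub_le_sub_left Q _)) (hx v2)
  have g3 := mul_le_mul_of_nonneg_left l (mul_nonneg (hx v1) (hx v2))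
  rw [hd]
  linarith

theorem sqrt3_bound : (5772 / 10000 : ℝ) ≤ √3 / 3 := by
  have : (1.732 : ℝ) ≤ √3 := Real.le_sqrt_of_sq_le (by norm_num)
  linarith

theorem lag_meet (hs : Sym3 eb) (hst : MeetK4 eb) (x : V → ℝ) (hx : ∀ v, 0 ≤ x v)
    (hsum : ∑ v, x v = 1) : dF eb x ≤ √3 / 3 := by
  by_cases hK : ∃ a b c d, isK4 eb a b c d
  · obtain ⟨a, b, c, d, hK⟩ := hK
    by_cases hP : ∃ i j k l u w, isK4 eb i j k l ∧ isK4 eb i j u w ∧ u ∉ [i, j, k, l] ∧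
        w ∉ [i, j, k, l]
    · obtain ⟨i, j, k, l, u, w, h1, h2, hu, hw⟩ := hP
      have b1 := hs.ne h1.1
      have b2 := hs.ne h1.2.1
      have b3 := hs.ne h1.2.2.1
      have b4 := hs.ne h2.2.2.1
      have hnd : [i, j, k, l, u, w].Nodup := by
        simp at hu hw ⊢
        refine ⟨⟨b1.1, b1.2.1, b2.2.1, Ne.symm hu.1, Ne.symm hw.1⟩, ⟨b1.2.2, b2.2.2, Ne.symm hu.2.1,
          Ne.symm hw.2.1⟩, ⟨b3.2.2, Ne.symm hu.2.2.1, Ne.symm hw.2.2.1⟩,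
          ⟨Ne.symm hu.2.2.2, Ne.symm hw.2.2.2⟩, b4.2.2⟩
      by_cases hQ : ∃ p q, p ∉ [i, j, k, l, u, w] ∧ q ∉ [i, j, k, l, u, w] ∧ isK4 eb i j p q
      · obtain ⟨p, q, hp, hq, h3⟩ := hQ
        have b5 := (hs.ne h3.2.2.1).2.2
        refine case2i hs hst x hx hsum i j k l u w p q ?_ h1 h2 h3
        simp at hp hq hnd ⊢
        obtain ⟨p1, p2, p3, p4, p5, p6⟩ := hp
        obtain ⟨q1, q2, q3, q4, q5, q6⟩ := hq
        obtain ⟨m1, m2, m3, m4, m5⟩ := hnd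
        clear hK h1 h2 h3 b1 b2 b3 b4
        grind
      · exact (case2ii hs hst x hx hsum i j k l u w hnd h1 h2 fun p q hp hq h3 =>
          hQ ⟨p, q, hp, hq, h3⟩).trans sqrt3_bound
    · exact (case1 hs hst x hx hsum a b c d hK fun i j k l u w h1 h2 h3 h4 =>
        hP ⟨i, j, k, l, u, w, h1, h2, h3, h4⟩).trans sqrt3_bound
  · have := flag_main eb hs.h12 hs.h23 (by
      intro a b c d
      by_contra h
      simp only [Bool.not_eq_false, Bool.and_eq_true] at h
      exact hK ⟨a, b, c, d, h.1.1.1, h.1.1.2, h.1.2, h.2⟩) x hx hsum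
    rw [d_eq]
    refine le_trans (le_trans this ?_) sqrt3_bound
    norm_num
end


section
variable {V : Type*} [Fintype V] [DecidableEq V] {eb : V → V → V → Bool}

theorem shift_aux (hs : Sym3 eb) (x : V → ℝ) (hx : ∀ v, 0 ≤ x v) (i j : V) (hij : i ≠ j)
    (hi : x i ≠ 0) (hj : x j ≠ 0) (hc : ∀ k, x k ≠ 0 → eb i j k = false)
    (y : V → ℝ) (off : ∀ v, y v ≠ 0 → v ≠ i ∧ v ≠ j)
    (hxy : ∀ v, v ≠ i → v ≠ j → y v = x v) (hsum : ∑ v, y v = ∑ v, x v - x i - x j)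
    (hd : dF eb x = dF eb y + 3 * (x i * qF eb y i + x j * qF eb y j)
        + 6 * (x i * x j * lF eb y i j)) (hq : qF eb y j ≤ qF eb y i) :
    ∃ z : V → ℝ, (∀ v, 0 ≤ z v) ∧ ∑ v, z v = ∑ v, x v ∧ dF eb x ≤ dF eb z ∧
      (univ.filter fun v => z v ≠ 0).card < (univ.filter fun v => x v ≠ 0).card := by
  obtain ⟨z, hz⟩ : ∃ z : V → ℝ, z = fun v => if v = i then x i + x j else if v = j then 0 else x v :=
    ⟨_, rfl⟩
  have zi : z i = x i + x j := by simp [hz]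
  have zj : z j = 0 := by simp [hz, hij.symm]
  have zv : ∀ v, v ≠ i → v ≠ j → z v = x v := fun v h1 h2 => by simp [hz, h1, h2]
  have z0 : ∀ v, 0 ≤ z v := fun v => by
    by_cases h1 : v = i
    · rw [h1, zi]; exact add_nonneg (hx _) (hx _)
    by_cases h2 : v = j
    · rw [h2, zj]
    rw [zv v h1 h2]; exact hx v
  obtain ⟨y', hy', off', hxy', hsum', hd'⟩ := peel2 hs z z0 i j (by simpa using hij)
  have hyy : y' = y := by
    funext v
    by_cases h1 : v = i
    · have a : y v = 0 := by by_contra h; exact (off v h).1 h1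
      have b : y' v = 0 := by by_contra h; exact (off' v h).1 h1
      rw [a, b]
    by_cases h2 : v = j
    · have a : y v = 0 := by by_contra h; exact (off v h).2 h2
      have b : y' v = 0 := by by_contra h; exact (off' v h).2 h2
      rw [a, b]
    rw [hxy v h1 h2, hxy' v h1 h2, zv v h1 h2]
  subst hyy
  have l0 : lF eb y' i j = 0 := l_zero y' i j fun w hw =>
    hc w (by rw [← hxy w (off w hw).1 (off w hw).2]; exact hw)
  refine ⟨z, z0, ?_, ?_, ?_⟩
  · rw [zi, zj] at hsum'; linarith
  · rw [hd', hd, zi, zj, l0]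
    have := mul_le_mul_of_nonneg_left hq (hx j)
    linarith
  · refine card_lt_card ⟨?_, ?_⟩
    · intro v
      simp only [mem_filter, mem_univ, true_and]
      intro h
      by_cases h1 : v = i
      · rw [h1]; exact hi
      by_cases h2 : v = j
      · rw [h2]; exact hj
      rwa [← zv v h1 h2]
    · intro h
      have : j ∈ univ.filter fun v => z v ≠ 0 := h (by simpa using hj)
      simp [zj] at this

theorem lag_star (hs : Sym3 eb)
    (hst : ∀ a b c d u v w, isK4 eb a b c d → eb u v w = true →
      (∀ p ∈ ({a, b, c, d} : Finset V), ∀ q ∈ ({u, v, w} : Finset V), p ≠ q ∧ ∃ k, eb p q k = true) →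
      False) :
    ∀ (n : ℕ) (x : V → ℝ), (univ.filter fun v => x v ≠ 0).card = n → (∀ v, 0 ≤ x v) →
      ∑ v, x v = 1 → dF eb x ≤ √3 / 3 := by
  intro n
  induction n using Nat.strong_induction_on with
  | _ n ih =>
  intro x hn hx hsum
  by_cases hA : ∃ i j, i ≠ j ∧ x i ≠ 0 ∧ x j ≠ 0 ∧ ∀ k, x k ≠ 0 → eb i j k = false
  · obtain ⟨i, j, hij, hi, hj, hc⟩ := hA
    obtain ⟨y, hy, off, hxy, hr, hd⟩ := peel2 hs x hx i j (by simpa using hij)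
    have : ∃ z : V → ℝ, (∀ v, 0 ≤ z v) ∧ ∑ v, z v = ∑ v, x v ∧ dF eb x ≤ dF eb z ∧
      (univ.filter fun v => z v ≠ 0).card < (univ.filter fun v => x v ≠ 0).card := by
      rcases le_total (qF eb y j) (qF eb y i) with h | h
      · exact shift_aux hs x hx i j hij hi hj hc y off hxy hr hd h
      · exact shift_aux hs x hx j i hij.symm hj hi (fun k hk => by rw [hs.h12]; exact hc k hk) y
          (fun v hv => (off v hv).symm) (fun v h1 h2 => hxy v h2 h1) (by rw [hr]; ring)
          (by rw [hd, hs.l12 y i j]; ring) h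
    obtain ⟨z, z0, zs, zd, zc⟩ := this
    exact zd.trans (ih _ (hn ▸ zc) z rfl z0 (by rw [zs, hsum]))
  · push Not at hA
    obtain ⟨eb', he⟩ : ∃ eb' : V → V → V → Bool, ∀ a b c, eb' a b c = true ↔
        eb a b c = true ∧ x a ≠ 0 ∧ x b ≠ 0 ∧ x c ≠ 0 := by
      classical
      exact ⟨fun a b c => decide (eb a b c = true ∧ x a ≠ 0 ∧ x b ≠ 0 ∧ x c ≠ 0), fun a b c => by
        simp only [decide_eq_true_eq]⟩
    have hs' : Sym3 eb' := by
      refine ⟨fun a b c => ?_, fun a b c => ?_, fun a c => ?_⟩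
      · rw [Bool.eq_iff_iff, he, he, hs.h12 a b c]; tauto
      · rw [Bool.eq_iff_iff, he, he, hs.h23 a b c]; tauto
      · rw [← Bool.not_eq_true, he, hs.irr]; simp
    have hd : dF eb x = dF eb' x := by
      rw [d_eq, d_eq]
      refine sum_congr rfl fun a _ => sum_congr rfl fun b _ => sum_congr rfl fun c _ => ?_
      by_cases ha : x a = 0
      · simp [ha]
      by_cases hb : x b = 0
      · simp [hb]
      by_cases hc : x c = 0
      · simp [hc]
      have : eb' a b c = eb a b c := by
        rw [Bool.eq_iff_iff, he]; tauto
      rw [ev, ev, this]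
    rw [hd]
    refine lag_meet hs' ?_ x hx hsum
    intro a b c d hK u v w huv
    by_contra hcon
    push Not at hcon
    obtain ⟨k1, k2, k3, k4⟩ := hK
    rw [he] at k1 k2 k3 k4 huv
    refine hst a b c d u v w ⟨k1.1, k2.1, k3.1, k4.1⟩ huv.1 fun p hp q hq => ?_
    have hpq : p ≠ q := by
      rintro rfl
      simp only [mem_insert, mem_singleton] at hq
      rcases hq with rfl | rfl | rfl
      · exact hcon.1 hp
      · exact hcon.2.1 hp
      · exact hcon.2.2 hp
    have xp : x p ≠ 0 := by
      simp only [mem_insert, mem_singleton] at hp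
      rcases hp with rfl | rfl | rfl | rfl
      · exact k1.2.1
      · exact k1.2.2.1
      · exact k1.2.2.2
      · exact k2.2.2.2
    have xq : x q ≠ 0 := by
      simp only [mem_insert, mem_singleton] at hq
      rcases hq with rfl | rfl | rfl
      · exact huv.2.1
      · exact huv.2.2.1
      · exact huv.2.2.2
    obtain ⟨k, _, hk⟩ := hA p q hpq xp xq
    exact ⟨hpq, k, by simpa using hk⟩
end


theorem clean_exists (E : Finset (Finset ℕ)) (N : Finset ℕ) (hN : ∀ e ∈ E, e ⊆ N) :
    ∃ F ⊆ E, E.card ≤ F.card + 20 * N.card ^ 2 ∧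
      ∀ a b, a ≠ b → (∃ e ∈ F, a ∈ e ∧ b ∈ e) →
        20 ≤ (F.filter fun e => a ∈ e ∧ b ∈ e).card := by
  classical
  obtain ⟨cov, hcov⟩ : ∃ cov : Finset (Finset ℕ) → Finset (Finset ℕ), cov = fun F =>
    (N.powersetCard 2).filter fun p => ∃ e ∈ F, p ⊆ e := ⟨_, rfl⟩
  obtain ⟨F, hF, hmax⟩ := exists_max_image E.powerset
    (fun F => (F.card : ℤ) - 20 * ((cov F).card : ℤ)) ⟨E, by simp⟩
  rw [mem_powerset] at hF
  refine ⟨F, hF, ?_, ?_⟩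
  · have h1 := hmax E (by simp)
    have h2 : (cov E).card ≤ N.card ^ 2 := by
      rw [hcov]
      refine (card_filter_le _ _).trans ?_
      rw [card_powersetCard]
      exact Nat.choose_le_pow _ _
    omega
  · rintro a b hab ⟨e, heF, ha, hb⟩
    have h1 := hmax (F.filter fun e => ¬ (a ∈ e ∧ b ∈ e))
      (by rw [mem_powerset]; exact (filter_subset _ _).trans hF)
    have h2 := card_filter_add_card_filter_not (s := F) (fun e => a ∈ e ∧ b ∈ e)
    have h3 : (cov (F.filter fun e => ¬ (a ∈ e ∧ b ∈ e))).card < (cov F).card := by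
      refine card_lt_card ⟨?_, ?_⟩
      · rw [hcov]
        intro p
        simp only [mem_filter]
        rintro ⟨hp, e, he, hpe⟩
        exact ⟨hp, e, he.1, hpe⟩
      · intro h
        have h4 : ({a, b} : Finset ℕ) ∈ cov F := by
          rw [hcov, mem_filter, mem_powersetCard]
          have : ({a, b} : Finset ℕ) ⊆ e := by
            intro z hz
            simp only [mem_insert, mem_singleton] at hz
            rcases hz with rfl | rfl <;> assumption
          exact ⟨⟨this.trans (hN e (hF heF)), card_pair hab⟩, e, heF, this⟩
        have h5 := h h4
        rw [hcov, mem_filter] at h5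
        obtain ⟨_, e', he', hs⟩ := h5
        rw [mem_filter] at he'
        exact he'.2 ⟨hs (by simp), hs (by simp)⟩
    omega

theorem codeg_third (F : Finset (Finset ℕ)) (N : Finset ℕ) (hN : ∀ e ∈ F, e ⊆ N)
    (h3 : ∀ e ∈ F, e.card = 3) (a b : ℕ) (hab : a ≠ b) :
    (F.filter fun e => a ∈ e ∧ b ∈ e).card ≤ (N.filter fun v => ({a, b, v} : Finset ℕ) ∈ F).card := by
  refine (card_le_card (t := (N.filter fun v => ({a, b, v} : Finset ℕ) ∈ F).image
    fun v => {a, b, v}) ?_).trans card_image_le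
  intro e he
  rw [mem_filter] at he
  obtain ⟨heF, ha, hb⟩ := he
  have hsub : ({a, b} : Finset ℕ) ⊆ e := by
    intro z hz
    simp only [mem_insert, mem_singleton] at hz
    rcases hz with rfl | rfl <;> assumption
  have : (e \ {a, b}).card = 1 := by
    rw [card_sdiff_of_subset hsub, h3 e heF, card_pair hab]
  obtain ⟨v, hv⟩ := card_eq_one.1 this
  have hve : e = {a, b, v} := by
    rw [← sdiff_union_of_subset hsub, hv]
    ext z; simp; tauto
  rw [mem_image]
  refine ⟨v, ?_, hve.symm⟩
  rw [mem_filter, ← hve]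
  exact ⟨hN e heF (by rw [hve]; simp), heF⟩

def newLabels : Finset ℕ := {15, 16, 17, 25, 26, 27, 35, 36, 37, 45, 46, 47}

theorem embed (G : ThreeGraph) (c : ℕ → ℕ) (hinj : Set.InjOn c ↑(Icc 1 7))
    (h1 : {c 1, c 2, c 3} ∈ G.edges) (h2 : {c 1, c 2, c 4} ∈ G.edges)
    (h3 : {c 1, c 3, c 4} ∈ G.edges) (h4 : {c 2, c 3, c 4} ∈ G.edges)
    (h5 : {c 5, c 6, c 7} ∈ G.edges)
    (hT : ∀ i ∈ Icc 1 4, ∀ j ∈ Icc 5 7,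
      20 ≤ (G.verts.filter fun v => ({c i, c j, v} : Finset ℕ) ∈ G.edges).card) :
    G.ContainsCopy ExtK43e := by
  classical
  have hdig : ∀ m ∈ newLabels, m / 10 ∈ Icc 1 4 ∧ m % 10 ∈ Icc 5 7 := by decide
  have hdis : ∀ m ∈ newLabels, m ∉ Icc 1 7 := by decide
  have hverts : ∀ m ∈ ExtK43e.verts, m ∈ Icc 1 7 ∨ m ∈ newLabels := by decide
  obtain ⟨g, ginj, hg⟩ := (Finset.all_card_le_biUnion_card_iff_exists_injective
    (fun m : newLabels => (G.verts.filter fun v => ({c (m.1 / 10), c (m.1 % 10), v} : Finset ℕ)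
      ∈ G.edges) \ (Icc 1 7).image c)).1 (by
      intro s
      rcases s.eq_empty_or_nonempty with rfl | ⟨m, hm⟩
      · simp
      · have a1 : s.card ≤ 12 := by
          refine (card_le_univ s).trans ?_
          rw [Fintype.card_coe]; decide
        have a2 := le_card_sdiff ((Icc 1 7).image c)
          (G.verts.filter fun v => ({c (m.1 / 10), c (m.1 % 10), v} : Finset ℕ) ∈ G.edges)
        have a3 := hT _ (hdig m.1 m.2).1 _ (hdig m.1 m.2).2
        have a4 : ((Icc 1 7).image c).card ≤ 7 := card_image_le.trans (by simp)
        have a5 := card_le_card (subset_biUnion_of_mem (fun m : newLabels =>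
          (G.verts.filter fun v => ({c (m.1 / 10), c (m.1 % 10), v} : Finset ℕ)
            ∈ G.edges) \ (Icc 1 7).image c) hm)
        omega)
  obtain ⟨f, hf⟩ : ∃ f : ℕ → ℕ, f = fun m => if h : m ∈ newLabels then g ⟨m, h⟩ else c m := ⟨_, rfl⟩
  have fc : ∀ m ∈ Icc 1 7, f m = c m := fun m hm => by
    rw [hf]
    exact dif_neg fun h => hdis m h hm
  have fg : ∀ m (h : m ∈ newLabels), f m = g ⟨m, h⟩ := fun m h => by
    rw [hf]
    exact dif_pos h
  have fe : ∀ m ∈ newLabels, ({c (m / 10), c (m % 10), f m} : Finset ℕ) ∈ G.edges ∧ f m ∈ G.verts ∧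
      f m ∉ (Icc 1 7).image c := fun m h => by
    have := hg ⟨m, h⟩
    rw [← fg m h] at this
    simp only [mem_sdiff, mem_filter] at this
    exact ⟨this.1.2, this.1.1, this.2⟩
  have f1 := fc 1 (by decide)
  have f2 := fc 2 (by decide)
  have f3 := fc 3 (by decide)
  have f4 := fc 4 (by decide)
  have f5 := fc 5 (by decide)
  have f6 := fc 6 (by decide)
  have f7 := fc 7 (by decide)
  refine ⟨f, ?_, ?_, ?_⟩
  · intro u hu v hv huv
    rcases hverts u hu with hu | hu <;> rcases hverts v hv with hv | hv
    · rw [fc u hu, fc v hv] at huv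
      exact hinj hu hv huv
    · exact absurd (huv ▸ fc u hu ▸ mem_image_of_mem c hu) (fe v hv).2.2
    · exact absurd (huv ▸ fc v hv ▸ mem_image_of_mem c hv) (fe u hu).2.2
    · rw [fg u hu, fg v hv] at huv
      simpa using ginj huv
  · intro v hv
    rcases hverts v hv with hv | hv
    · rw [fc v hv]
      have m1 := G.edges_sub _ h1
      have m2 := G.edges_sub _ h2
      have m5 := G.edges_sub _ h5
      rw [mem_Icc] at hv
      obtain ⟨hv1, hv2⟩ := hv
      interval_cases v
      · exact m1 (by simp)
      · exact m1 (by simp)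
      · exact m1 (by simp)
      · exact m2 (by simp)
      · exact m5 (by simp)
      · exact m5 (by simp)
      · exact m5 (by simp)
    · exact (fe v hv).2.1
  · intro e he
    simp only [ExtK43e, mem_insert, mem_singleton] at he
    rcases he with rfl | rfl | rfl | rfl | rfl | rfl | rfl | rfl | rfl | rfl | rfl | rfl | rfl | rfl |
      rfl | rfl | rfl <;> simp only [image_insert, image_singleton, f1, f2, f3, f4, f5, f6, f7]
    · exact h1
    · exact h2
    · exact h3
    · exact h4
    · exact h5
    · exact (fe 15 (by decide)).1
    · exact (fe 16 (by decide)).1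
    · exact (fe 17 (by decide)).1
    · exact (fe 25 (by decide)).1
    · exact (fe 26 (by decide)).1
    · exact (fe 27 (by decide)).1
    · exact (fe 35 (by decide)).1
    · exact (fe 36 (by decide)).1
    · exact (fe 37 (by decide)).1
    · exact (fe 45 (by decide)).1
    · exact (fe 46 (by decide)).1
    · exact (fe 47 (by decide)).1

theorem six_card {α : Type*} [DecidableEq α] (p q r : α) (hpq : p ≠ q) (hpr : p ≠ r) (hqr : q ≠ r) :
    ({(p, q, r), (p, r, q), (q, p, r), (q, r, p), (r, p, q), (r, q, p)} : Finset (α × α × α)).card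
      = 6 := by
  rw [card_insert_of_notMem, card_insert_of_notMem, card_insert_of_notMem, card_insert_of_notMem,
      card_insert_of_notMem, card_singleton] <;> simp [hpq, hpr, hqr, hpq.symm, hpr.symm, hqr.symm]

theorem count6 (N : Finset ℕ) (F : Finset (Finset ℕ)) (hN : ∀ e ∈ F, e ⊆ N)
    (h3 : ∀ e ∈ F, e.card = 3) :
    6 * F.card ≤ ((univ : Finset (N × N × N)).filter fun t =>
      ({t.1.1, t.2.1.1, t.2.2.1} : Finset ℕ) ∈ F).card := by
  classical
  rw [card_eq_sum_card_fiberwise (t := F)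
    (f := fun t : N × N × N => ({t.1.1, t.2.1.1, t.2.2.1} : Finset ℕ))
    (fun t ht => by simpa using ht), mul_comm, ← smul_eq_mul]
  refine card_nsmul_le_sum _ _ _ fun e he => ?_
  obtain ⟨p, q, r, hpq, hpr, hqr, rfl⟩ := card_eq_three.1 (h3 e he)
  obtain ⟨P, rfl⟩ : ∃ P : N, P.1 = p := ⟨⟨p, hN _ he (by simp)⟩, rfl⟩
  obtain ⟨Q, rfl⟩ : ∃ P : N, P.1 = q := ⟨⟨q, hN _ he (by simp)⟩, rfl⟩
  obtain ⟨R, rfl⟩ : ∃ P : N, P.1 = r := ⟨⟨r, hN _ he (by simp)⟩, rfl⟩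
  have hpq : P ≠ Q := fun h => hpq (congrArg _ h)
  have hpr : P ≠ R := fun h => hpr (congrArg _ h)
  have hqr : Q ≠ R := fun h => hqr (congrArg _ h)
  have key : ∀ a b c : N, ({a.1, b.1, c.1} : Finset ℕ) = {P.1, Q.1, R.1} →
      (a, b, c) ∈ ((univ : Finset (N × N × N)).filter fun t =>
      ({t.1.1, t.2.1.1, t.2.2.1} : Finset ℕ) ∈ F).filter fun t =>
      ({t.1.1, t.2.1.1, t.2.2.1} : Finset ℕ) = {P.1, Q.1, R.1} := by
    intro a b c h
    rw [mem_filter, mem_filter]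
    exact ⟨⟨mem_univ _, by rw [h]; exact he⟩, h⟩
  rw [← six_card P Q R hpq hpr hqr]
  refine card_le_card ?_
  intro t ht
  simp only [mem_insert, mem_singleton] at ht
  rcases ht with rfl | rfl | rfl | rfl | rfl | rfl
  · exact key _ _ _ rfl
  · exact key _ _ _ (by rw [pair_comm])
  · exact key _ _ _ (by rw [insert_comm])
  · exact key _ _ _ (by rw [pair_comm, insert_comm])
  · exact key _ _ _ (by rw [insert_comm, pair_comm R.1])
  · exact key _ _ _ (by rw [pair_comm, insert_comm, pair_comm R.1])

theorem upper (n : ℕ) (hn : 1 ≤ n) (G : ThreeGraph) (hv : G.verts = Icc 1 n) (hfree : G.Free ExtK43e) :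
    (G.edges.card : ℝ) ≤ √3 / 18 * n ^ 3 + 20 * n ^ 2 := by
  classical
  obtain ⟨F, hFE, hcard, hdeg⟩ := clean_exists G.edges G.verts G.edges_sub
  have h3 : ∀ e ∈ F, e.card = 3 := fun e he => G.card_eq e (hFE he)
  have hsub : ∀ e ∈ F, e ⊆ G.verts := fun e he => G.edges_sub e (hFE he)
  obtain ⟨eb, he⟩ : ∃ eb : G.verts → G.verts → G.verts → Bool, ∀ a b c, eb a b c = true ↔
      ({a.1, b.1, c.1} : Finset ℕ) ∈ F := ⟨fun a b c => decide (({a.1, b.1, c.1} : Finset ℕ) ∈ F),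
        fun a b c => by simp⟩
  have hs : Sym3 eb := by
    refine ⟨fun a b c => ?_, fun a b c => ?_, fun a c => ?_⟩
    · rw [Bool.eq_iff_iff, he, he, insert_comm]
    · rw [Bool.eq_iff_iff, he, he, pair_comm b.1 c.1]
    · rw [← Bool.not_eq_true, he]
      intro h
      have := h3 _ h
      rw [insert_eq_of_mem (by simp)] at this
      have := card_le_two (a := a.1) (b := c.1)
      omega
  have hn0 : (0:ℝ) < n := by exact_mod_cast hn
  have cardV : G.verts.card = n := by rw [hv]; simp
  have L := lag_star hs (by
    intro a b c d u v w hK huv hcross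
    apply hfree
    obtain ⟨k1, k2, k3, k4⟩ := hK
    have b1 := hs.ne k1
    have b2 := hs.ne k2
    have b3 := hs.ne k3
    have b4 := hs.ne huv
    rw [he] at k1 k2 k3 k4 huv
    have hc : ∀ p ∈ ({a, b, c, d} : Finset G.verts), ∀ q ∈ ({u, v, w} : Finset G.verts), p.1 ≠ q.1 ∧
        20 ≤ (G.verts.filter fun z => ({p.1, q.1, z} : Finset ℕ) ∈ G.edges).card := by
      intro p hp q hq
      obtain ⟨hpq, k, hk⟩ := hcross p hp q hq
      have hpq : p.1 ≠ q.1 := fun h => hpq (Subtype.ext h)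
      rw [he] at hk
      refine ⟨hpq, (hdeg p.1 q.1 hpq ⟨_, hk, by simp, by simp⟩).trans
        ((codeg_third F G.verts hsub h3 p.1 q.1 hpq).trans (card_le_card ?_))⟩
      intro z
      simp only [mem_filter]
      exact fun h => ⟨h.1, hFE h.2⟩
    simp only [ne_eq, ← Subtype.coe_inj] at b1 b2 b3 b4
    simp only [mem_insert, mem_singleton, forall_eq_or_imp, forall_eq] at hc
    obtain ⟨⟨⟨a5, A5⟩, ⟨a6, A6⟩, a7, A7⟩, ⟨⟨c5, C5⟩, ⟨c6, C6⟩, c7, C7⟩, ⟨⟨d5, D5⟩, ⟨d6, D6⟩, d7, D7⟩,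
      ⟨e5, E5⟩, ⟨e6, E6⟩, e7, E7⟩ := hc
    refine embed G (fun m => if m = 1 then a.1 else if m = 2 then b.1 else if m = 3 then c.1 else
      if m = 4 then d.1 else if m = 5 then u.1 else if m = 6 then v.1 else w.1) ?_
      (hFE k1) (hFE k2) (hFE k3) (hFE k4) (hFE huv) ?_
    · intro i hi j hj hij
      simp only [coe_Icc, Set.mem_Icc] at hi hj
      obtain ⟨b11, b12, b13⟩ := b1
      obtain ⟨b21, b22, b23⟩ := b2
      obtain ⟨b31, b32, b33⟩ := b3
      obtain ⟨b41, b42, b43⟩ := b4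
      clear hcross k1 k2 k3 k4 huv A5 A6 A7 C5 C6 C7 D5 D6 D7 E5 E6 E7
      obtain ⟨hi1, hi2⟩ := hi
      obtain ⟨hj1, hj2⟩ := hj
      interval_cases i <;> interval_cases j <;> first | rfl | (exfalso; simp at hij; grind)
    · intro i hi j hj
      simp only [mem_Icc] at hi hj
      obtain ⟨hi1, hi2⟩ := hi
      obtain ⟨hj1, hj2⟩ := hj
      interval_cases i <;> interval_cases j <;> simp only [] <;> assumption) _
    (fun _ => 1 / (n:ℝ)) rfl (fun _ => by positivity) (by
      rw [sum_const, card_univ, Fintype.card_coe, cardV]; simp; field_simp)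
  have hd : dF eb (fun _ => 1 / (n:ℝ)) = (1 / (n:ℝ))^3 *
      ((univ : Finset (G.verts × G.verts × G.verts)).filter fun t =>
      ({t.1.1, t.2.1.1, t.2.2.1} : Finset ℕ) ∈ F).card := by
    rw [d_eq, card_filter, Fintype.sum_prod_type]
    push_cast
    rw [mul_sum]
    refine sum_congr rfl fun a _ => ?_
    rw [Fintype.sum_prod_type, mul_sum]
    refine sum_congr rfl fun b _ => ?_
    rw [mul_sum]
    refine sum_congr rfl fun c _ => ?_
    by_cases h : eb a b c = true
    · rw [ev_one h, if_pos ((he a b c).1 h)]; ring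
    · rw [ev_zero (by simpa using h), if_neg (fun h' => h ((he a b c).2 h'))]; ring
  have C := count6 G.verts F hsub h3
  rw [hd] at L
  have C' : (6 * F.card : ℝ) ≤ ((univ : Finset (G.verts × G.verts × G.verts)).filter fun t =>
      ({t.1.1, t.2.1.1, t.2.2.1} : Finset ℕ) ∈ F).card := by exact_mod_cast C
  have hcard' : (G.edges.card : ℝ) ≤ F.card + 20 * n ^ 2 := by
    rw [cardV] at hcard
    exact_mod_cast hcard
  rw [one_div, inv_pow, inv_mul_le_iff₀ (by positivity)] at L
  linarith


def lowG (n k : ℕ) : ThreeGraph where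
  verts := Icc 1 n
  edges := ((Icc 1 n).powersetCard 3).filter fun e =>
    (∀ x ∈ e, ∀ y ∈ e, x ≠ y → ¬ (x ≤ k ∧ y ≤ k) ∧ ¬ (k < x ∧ x ≤ 2 * k ∧ k < y ∧ y ≤ 2 * k)) ∧
      ∃ x ∈ e, x ≤ 2 * k
  edges_sub := by
    intro e he
    rw [mem_filter, mem_powersetCard] at he
    exact he.1.1
  card_eq := by
    intro e he
    rw [mem_filter, mem_powersetCard] at he
    exact he.1.2

theorem ext_pairs : ∀ i ∈ Icc 1 7, ∀ j ∈ Icc 1 7, i ≠ j → ∃ e ∈ ExtK43e.edges, i ∈ e ∧ j ∈ e := by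
  decide

theorem mem_lowG {n k : ℕ} {e : Finset ℕ} (h : e ∈ (lowG n k).edges) :
    (∀ x ∈ e, ∀ y ∈ e, x ≠ y → ¬ (x ≤ k ∧ y ≤ k) ∧ ¬ (k < x ∧ x ≤ 2 * k ∧ k < y ∧ y ≤ 2 * k)) ∧
      ∃ x ∈ e, x ≤ 2 * k := (mem_filter.1 h).2

theorem prop_aux {a b c d : Prop} (h12 : a → b → False) (h13 : a → c → False)
    (h14 : a → d → False) (h23 : b → c → False) (h24 : b → d → False) (h34 : c → d → False)
    (e1 : a ∨ b ∨ c) (e2 : a ∨ b ∨ d) (e3 : a ∨ c ∨ d) (e4 : b ∨ c ∨ d) : False := by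
  by_cases ha : a <;> by_cases hb : b <;> by_cases hc : c <;> by_cases hd : d <;> simp_all

theorem lowG_free (n k : ℕ) : (lowG n k).Free ExtK43e := by
  rintro ⟨f, hinj, -, hf⟩
  have core : ∀ i ∈ Icc 1 7, i ∈ ExtK43e.verts := by decide
  have hp : ∀ i ∈ Icc 1 7, ∀ j ∈ Icc 1 7, i ≠ j →
      ¬ (f i ≤ k ∧ f j ≤ k) ∧ ¬ (k < f i ∧ f i ≤ 2 * k ∧ k < f j ∧ f j ≤ 2 * k) := by
    intro i hi j hj hij
    obtain ⟨e, he, h1, h2⟩ := ext_pairs i hi j hj hij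
    have := hf e he
    have this := mem_lowG this
    exact this.1 _ (mem_image_of_mem f h1) _ (mem_image_of_mem f h2)
      fun h => hij (hinj (core i hi) (core j hj) h)
  have ht : ∀ i ∈ Icc 1 7, ∀ j ∈ Icc 1 7, ∀ l ∈ Icc 1 7, i ≠ j → i ≠ l → j ≠ l →
      f i ≤ 2 * k → f j ≤ 2 * k → f l ≤ 2 * k → False := by
    intro i hi j hj l hl h1 h2 h3 a b c
    have := hp i hi j hj h1
    have := hp i hi l hl h2
    have := hp j hj l hl h3
    omega
  have he : ∀ a b c, {a, b, c} ∈ ExtK43e.edges → f a ≤ 2 * k ∨ f b ≤ 2 * k ∨ f c ≤ 2 * k := by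
    intro a b c h
    have := hf _ h
    have this := mem_lowG this
    obtain ⟨x, hx, hk⟩ := this.2
    simp only [image_insert, image_singleton, mem_insert, mem_singleton] at hx
    rcases hx with rfl | rfl | rfl
    · exact Or.inl hk
    · exact Or.inr (Or.inl hk)
    · exact Or.inr (Or.inr hk)
  obtain ⟨l, hl, hlk⟩ : ∃ l ∈ Icc 5 7, f l ≤ 2 * k := by
    rcases he 5 6 7 (by decide) with h | h | h
    · exact ⟨5, by decide, h⟩
    · exact ⟨6, by decide, h⟩
    · exact ⟨7, by decide, h⟩
  rw [mem_Icc] at hl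
  have h2 : ∀ i j, i ∈ Icc 1 4 → j ∈ Icc 1 4 → i ≠ j → f i ≤ 2 * k → f j ≤ 2 * k → False := by
    intro i j hi hj hij a b
    rw [mem_Icc] at hi hj
    exact ht i (by rw [mem_Icc]; omega) j (by rw [mem_Icc]; omega) l (by rw [mem_Icc]; omega) hij
      (by omega) (by omega) a b hlk
  have h12 := h2 1 2 (by decide) (by decide) (by decide)
  have h13 := h2 1 3 (by decide) (by decide) (by decide)
  have h14 := h2 1 4 (by decide) (by decide) (by decide)
  have h23 := h2 2 3 (by decide) (by decide) (by decide)
  have h24 := h2 2 4 (by decide) (by decide) (by decide)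
  have h34 := h2 3 4 (by decide) (by decide) (by decide)
  have e1 := he 1 2 3 (by decide)
  have e2 := he 1 2 4 (by decide)
  have e3 := he 1 3 4 (by decide)
  have e4 := he 2 3 4 (by decide)
  exact prop_aux h12 h13 h14 h23 h24 h34 e1 e2 e3 e4

theorem sorted_inj {a b c a' b' c' : ℕ} (h1 : a < b) (h2 : b < c) (h1' : a' < b') (h2' : b' < c')
    (h : ({a, b, c} : Finset ℕ) = {a', b', c'}) : a = a' ∧ b = b' ∧ c = c' := by
  have m1 : a ∈ ({a', b', c'} : Finset ℕ) := h ▸ (by simp)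
  have m2 : b ∈ ({a', b', c'} : Finset ℕ) := h ▸ (by simp)
  have m3 : c ∈ ({a', b', c'} : Finset ℕ) := h ▸ (by simp)
  simp only [mem_insert, mem_singleton] at m1 m2 m3
  omega

theorem pairs_card (B : Finset ℕ) :
    B.card.choose 2 ≤ ((B ×ˢ B).filter fun p => p.1 < p.2).card := by
  rw [← card_powersetCard]
  refine (card_le_card (t := ((B ×ˢ B).filter fun p => p.1 < p.2).image fun p => {p.1, p.2}) ?_).trans
    card_image_le
  intro e he
  rw [mem_powersetCard] at he
  obtain ⟨x, y, hxy, rfl⟩ := card_eq_two.1 he.2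
  have hx := he.1 (show x ∈ ({x, y} : Finset ℕ) by simp)
  have hy := he.1 (show y ∈ ({x, y} : Finset ℕ) by simp)
  rw [mem_image]
  rcases lt_or_gt_of_ne hxy with h | h
  · exact ⟨(x, y), by simp [hx, hy, h], rfl⟩
  · exact ⟨(y, x), by simp [hx, hy, h], pair_comm _ _⟩

theorem lowG_card (n k : ℕ) (hk : 2 * k ≤ n) :
    k * k * (n - 2 * k) + 2 * k * (n - 2 * k).choose 2 ≤ (lowG n k).edges.card := by
  obtain ⟨T1, hT1⟩ : ∃ T : Finset (ℕ × ℕ × ℕ), T = Icc 1 k ×ˢ Icc (k + 1) (2 * k) ×ˢ Icc (2 * k + 1) n :=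
    ⟨_, rfl⟩
  obtain ⟨T2, hT2⟩ : ∃ T : Finset (ℕ × ℕ × ℕ), T = Icc 1 (2 * k) ×ˢ
    ((Icc (2 * k + 1) n ×ˢ Icc (2 * k + 1) n).filter fun p => p.1 < p.2) := ⟨_, rfl⟩
  have c1 : T1.card = k * k * (n - 2 * k) := by
    rw [hT1, card_product, card_product, Nat.card_Icc, Nat.card_Icc, Nat.card_Icc,
      show k + 1 - 1 = k by omega, show 2 * k + 1 - (k + 1) = k by omega,
      show n + 1 - (2 * k + 1) = n - 2 * k by omega]
    ring
  have c2 : 2 * k * (n - 2 * k).choose 2 ≤ T2.card := by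
    have := pairs_card (Icc (2 * k + 1) n)
    rw [Nat.card_Icc, show n + 1 - (2 * k + 1) = n - 2 * k by omega] at this
    rw [hT2, card_product, Nat.card_Icc, show 2 * k + 1 - 1 = 2 * k by omega]
    exact Nat.mul_le_mul_left _ this
  have m1 : ∀ t ∈ T1, 1 ≤ t.1 ∧ t.1 ≤ k ∧ k < t.2.1 ∧ t.2.1 ≤ 2 * k ∧ 2 * k < t.2.2 ∧ t.2.2 ≤ n := by
    intro t ht
    rw [hT1] at ht
    simp only [mem_product, mem_Icc] at ht
    omega
  have m2 : ∀ t ∈ T2, 1 ≤ t.1 ∧ t.1 ≤ 2 * k ∧ 2 * k < t.2.1 ∧ t.2.1 < t.2.2 ∧ t.2.2 ≤ n := by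
    intro t ht
    rw [hT2] at ht
    simp only [mem_product, mem_Icc, mem_filter] at ht
    omega
  have hdis : Disjoint T1 T2 := by
    rw [disjoint_left]
    intro t h1 h2
    have := m1 t h1
    have := m2 t h2
    omega
  have hU : ∀ t ∈ T1 ∪ T2, t.1 < t.2.1 ∧ t.2.1 < t.2.2 := by
    intro t ht
    rw [mem_union] at ht
    rcases ht with h | h
    · have := m1 t h; omega
    · have := m2 t h; omega
  have hcard : (T1 ∪ T2).card ≤ (lowG n k).edges.card := by
    refine card_le_card_of_injOn (fun t => {t.1, t.2.1, t.2.2}) ?_ ?_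
    · intro t ht
      have hlt := hU t ht
      have ht : t ∈ T1 ∪ T2 := ht
      rw [mem_union] at ht
      have hcase : (1 ≤ t.1 ∧ t.1 ≤ k ∧ k < t.2.1 ∧ t.2.1 ≤ 2 * k ∧ 2 * k < t.2.2 ∧ t.2.2 ≤ n) ∨
        (1 ≤ t.1 ∧ t.1 ≤ 2 * k ∧ 2 * k < t.2.1 ∧ t.2.1 < t.2.2 ∧ t.2.2 ≤ n) :=
        ht.imp (m1 t) (m2 t)
      obtain ⟨a, b, c⟩ := t
      simp only at hcase hlt
      change ({a, b, c} : Finset ℕ) ∈ (lowG n k).edges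
      rw [lowG, mem_filter, mem_powersetCard]
      refine ⟨⟨?_, ?_⟩, ?_, a, by simp, by omega⟩
      · intro z hz
        simp only [mem_insert, mem_singleton] at hz
        rw [mem_Icc]
        omega
      · rw [card_eq_three]
        exact ⟨a, b, c, by omega, by omega, by omega, rfl⟩
      · intro z hz w hw
        simp only [mem_insert, mem_singleton] at hz hw
        omega
    · intro t ht s hs h
      have a1 := hU t ht
      have a2 := hU s hs
      obtain ⟨e1, e2, e3⟩ := sorted_inj a1.1 a1.2 a2.1 a2.2 h
      ext
      · exact e1
      · exact e2
      · exact e3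
  rw [card_union_of_disjoint hdis, c1] at hcard
  omega

theorem turan_bdd (n : ℕ) : BddAbove {m : ℕ | ∃ G : ThreeGraph, G.verts = Finset.Icc 1 n ∧
    G.Free ExtK43e ∧ G.edges.card = m} := by
  refine ⟨((Icc 1 n).powerset).card, ?_⟩
  rintro m ⟨G, hv, -, rfl⟩
  refine card_le_card fun e he => ?_
  rw [mem_powerset, ← hv]
  exact G.edges_sub e he

theorem turan_lower (n k : ℕ) (hk : 2 * k ≤ n) :
    k * k * (n - 2 * k) + 2 * k * (n - 2 * k).choose 2 ≤ turanNumber ExtK43e n :=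
  (lowG_card n k hk).trans (le_csSup (turan_bdd n) ⟨lowG n k, rfl, lowG_free n k, rfl⟩)

theorem turan_upper (n : ℕ) (hn : 1 ≤ n) :
    (turanNumber ExtK43e n : ℝ) ≤ √3 / 18 * n ^ 3 + 20 * n ^ 2 := by
  have : turanNumber ExtK43e n ∈ {m : ℕ | ∃ G : ThreeGraph, G.verts = Finset.Icc 1 n ∧
    G.Free ExtK43e ∧ G.edges.card = m} :=
    Nat.sSup_mem ⟨_, lowG n 0, rfl, lowG_free n 0, rfl⟩ (turan_bdd n)
  obtain ⟨G, hv, hf, hc⟩ := this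
  rw [← hc]
  exact upper n hn G hv hf

theorem choose3 (n : ℕ) : (n.choose 3 : ℝ) = (n : ℝ) * (n - 1) * (n - 2) / 6 := by
  induction n with
  | zero => simp
  | succ m ih =>
    rw [Nat.choose_succ_succ, Nat.cast_add, ih, Nat.cast_choose_two]
    push_cast
    ring

theorem tend_inv : Filter.Tendsto (fun n : ℕ => 1 / (n : ℝ)) Filter.atTop (nhds 0) :=
  tendsto_one_div_atTop_nhds_zero_nat

theorem tend_turan : Filter.Tendsto (fun n : ℕ => (turanNumber ExtK43e n : ℝ) / (n : ℝ) ^ 3)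
    Filter.atTop (nhds (√3 / 18)) := by
  have s3 : √3 ^ 2 = 3 := Real.sq_sqrt (by norm_num)
  have s0 : 0 ≤ √3 := Real.sqrt_nonneg 3
  have s1 : √3 ≤ 2 := by nlinarith
  obtain ⟨α, hα⟩ : ∃ α : ℝ, α = (3 - √3) / 6 := ⟨_, rfl⟩
  have hα0 : 0 ≤ α := by rw [hα]; linarith
  have hα2 : 2 * α ≤ 1 := by rw [hα]; linarith
  have tk : Filter.Tendsto (fun n : ℕ => (⌊α * (n:ℝ)⌋₊ : ℝ) / (n : ℝ)) Filter.atTop (nhds α) :=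
    (tendsto_nat_floor_mul_div_atTop hα0).comp tendsto_natCast_atTop_atTop
  have tl : Filter.Tendsto (fun n : ℕ =>
      ((⌊α * (n:ℝ)⌋₊ : ℝ) / (n : ℝ)) ^ 2 * (1 - 2 * ((⌊α * (n:ℝ)⌋₊ : ℝ) / (n : ℝ)))
      + ((⌊α * (n:ℝ)⌋₊ : ℝ) / (n : ℝ)) * (1 - 2 * ((⌊α * (n:ℝ)⌋₊ : ℝ) / (n : ℝ))) *
        (1 - 2 * ((⌊α * (n:ℝ)⌋₊ : ℝ) / (n : ℝ)) - 1 / (n : ℝ))) Filter.atTop (nhds (√3 / 18)) := by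
    have tb := (tk.const_mul 2).const_sub 1
    have := ((tk.pow 2).mul tb).add ((tk.mul tb).mul (tb.sub tend_inv))
    convert this using 2
    rw [hα]
    linear_combination (√3/108) * s3
  have tu : Filter.Tendsto (fun n : ℕ => √3 / 18 + 20 * (1 / (n : ℝ))) Filter.atTop
      (nhds (√3 / 18)) := by
    simpa using (tend_inv.const_mul 20).const_add (√3 / 18)
  refine tendsto_of_tendsto_of_tendsto_of_le_of_le' tl tu ?_ ?_
  · filter_upwards [Filter.eventually_ge_atTop 1] with n hn
    have hn0 : (0:ℝ) < n := by exact_mod_cast hn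
    obtain ⟨k, hk⟩ : ∃ k, k = ⌊α * (n:ℝ)⌋₊ := ⟨_, rfl⟩
    rw [← hk]
    have hkn : (k : ℝ) ≤ α * n := hk ▸ Nat.floor_le (by positivity)
    have h2 : 2 * k ≤ n := by
      have : (2 * k : ℝ) ≤ n := by nlinarith
      exact_mod_cast this
    have L := turan_lower n k h2
    have L' : ((k * k * (n - 2 * k) + 2 * k * (n - 2 * k).choose 2 : ℕ) : ℝ)
      ≤ turanNumber ExtK43e n := by exact_mod_cast L
    rw [Nat.cast_add, Nat.cast_mul, Nat.cast_mul, Nat.cast_mul, Nat.cast_choose_two,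
      Nat.cast_sub h2] at L'
    push_cast at L'
    rw [le_div_iff₀ (by positivity)]
    refine le_trans (le_of_eq ?_) L'
    field_simp
  · filter_upwards [Filter.eventually_ge_atTop 1] with n hn
    have hn0 : (0:ℝ) < n := by exact_mod_cast hn
    rw [div_le_iff₀ (by positivity)]
    refine (turan_upper n hn).trans (le_of_eq ?_)
    field_simp

theorem tend_choose : Filter.Tendsto (fun n : ℕ => (n.choose 3 : ℝ) / (n : ℝ) ^ 3)
    Filter.atTop (nhds (1 / 6)) := by
  have h : Filter.Tendsto (fun n : ℕ => (1 - 1 / (n:ℝ)) * (1 - 2 * (1 / (n:ℝ))) / 6)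
      Filter.atTop (nhds (1 / 6)) := by
    simpa using ((tend_inv.const_sub 1).mul ((tend_inv.const_mul 2).const_sub 1)).div_const 6
  refine h.congr' ?_
  filter_upwards [Filter.eventually_ge_atTop 1] with n hn
  have hn0 : (0:ℝ) < n := by exact_mod_cast hn
  rw [choose3]
  field_simp

theorem final_tendsto :
    Filter.Tendsto (fun n : ℕ => (turanNumber ExtK43e n : ℝ) / (Nat.choose n 3 : ℝ))
      Filter.atTop (nhds (Real.sqrt 3 / 3)) := by
  have h := tend_turan.div tend_choose (by norm_num)
  rw [show √3 / 18 / (1 / 6) = √3 / 3 by ring] at h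
  refine h.congr' ?_
  filter_upwards [Filter.eventually_ge_atTop 1] with n hn
  have hn0 : (0:ℝ) < n := by exact_mod_cast hn
  simp only [Pi.div_apply]
  rw [div_div_div_cancel_right₀ (by positivity)]

theorem final_irr : Irrational (Real.sqrt 3 / 3) := by
  have h := (Nat.Prime.irrational_sqrt (show Nat.Prime 3 by norm_num)).div_natCast
    (m := 3) (by norm_num)
  exact_mod_cast h


/-- The Turán density of the extension of `K_4^3 ∪ e` is `√3 / 3`; in particular it
is irrational, so there is a single 3-uniform graph with irrational Turán density. -/
theorem turanDensity_ExtK43e :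
    Filter.Tendsto (fun n : ℕ => (turanNumber ExtK43e n : ℝ) / (Nat.choose n 3 : ℝ))
      Filter.atTop (nhds (Real.sqrt 3 / 3)) ∧ Irrational (Real.sqrt 3 / 3) :=
  ⟨final_tendsto, final_irr⟩
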